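/- For all integers k ≥ 1, m ≥ 1 and all x < y in ℝ, lim_{n→∞} P( M̃_n^{(k)} ≤ u_n(x), M_n^{(m)} ≤ u_n(y) ) = ∑_{t=0}^{m−1} ∑_{i=0}^{m−t−1} ∑_{j=i}^{k−1} E ∫_{−∞}^{+∞} [ ((1−λ) g(y,z))^t / t! · exp(−(1−λ) g(y,z)) · (λ g(y,z))^i / i! · (λ (g(x,z) − g(y,z)))^{j−i} / (j−i)! · exp(−λ g(x,z)) ] dΦ(z). -/

import Mathlib

open MeasureTheory ProbabilityTheory Filter Real
open scoped Classical NNReal ENNReal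

/-- The normalizing levels `u_n(x) = x/a_n + b_n` with `a_n = (2 ln n)^{1/2}` and
`b_n = a_n - (ln ln n + ln (4π))/(2 a_n)`. -/
noncomputable def un (n : ℕ) (x : ℝ) : ℝ :=
  x / Real.sqrt (2 * Real.log n) +
    (Real.sqrt (2 * Real.log n) -
      (Real.log (Real.log n) + Real.log (4 * Real.pi)) / (2 * Real.sqrt (2 * Real.log n)))

/-- `g(x,z) = exp(-x - γ + √(2γ) z)`. -/
noncomputable def g (γ x z : ℝ) : ℝ := Real.exp (-x - γ + Real.sqrt (2 * γ) * z)

lemma hasDerivAt_gaussianPDFReal_zero {v : ℝ≥0} (hv : v ≠ 0) (x : ℝ) :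
    HasDerivAt (gaussianPDFReal 0 v) (-(x / v) * gaussianPDFReal 0 v x) x := by
  have hv' : (v : ℝ) ≠ 0 := by exact_mod_cast hv
  rw [gaussianPDFReal_def]
  have h1 : HasDerivAt (fun x : ℝ => -(x - 0) ^ 2 / (2 * (v : ℝ))) (-(x / v)) x := by
    have := (((hasDerivAt_id x).sub_const 0).pow 2).neg.div_const (2 * (v : ℝ))
    refine this.congr_deriv ?_
    simp only [id]
    field_simp
    ring
  have := (h1.exp.const_mul (√(2 * π * v))⁻¹)
  refine this.congr_deriv ?_
  ring

/-- Integration by parts for a centered real Gaussian measure. -/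
lemma integral_mul_gaussianReal_eq {v : ℝ≥0} {f f' : ℝ → ℝ} {C C' : ℝ}
    (hf : ∀ x, HasDerivAt f (f' x) x) (hC : ∀ x, |f x| ≤ C) (hC' : ∀ x, |f' x| ≤ C') :
    ∫ x, x * f x ∂gaussianReal 0 v = v * ∫ x, f' x ∂gaussianReal 0 v := by
  by_cases hv : v = 0
  · subst hv; simp [gaussianReal_zero_var]
  have hv' : (v : ℝ) ≠ 0 := by exact_mod_cast hv
  have hfm : Measurable f :=
    (continuous_iff_continuousAt.2 fun x => (hf x).continuousAt).measurable
  have hf' : f' = deriv f := funext fun x => (hf x).deriv.symm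
  have hfm' : Measurable f' := hf' ▸ measurable_deriv f
  have hid : Integrable (fun x : ℝ => x) (gaussianReal 0 v) :=
    (memLp_id_gaussianReal 1).integrable (by norm_num)
  have hid' : Integrable (fun x : ℝ => gaussianPDFReal 0 v x * x) := by
    have := hid
    rw [gaussianReal_of_var_ne_zero _ hv, integrable_withDensity_iff_integrable_smul'
      (measurable_gaussianPDF _ _) (ae_of_all _ fun _ => gaussianPDF_lt_top)] at this
    simpa [toReal_gaussianPDF] using this
  have hpdf := integrable_gaussianPDFReal 0 v
  rw [integral_gaussianReal_eq_integral_smul hv, integral_gaussianReal_eq_integral_smul hv]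
  have key := integral_mul_deriv_eq_deriv_mul_of_integrable
    (u := f) (v := gaussianPDFReal 0 v) (u' := f')
    (v' := fun x => -(x / v) * gaussianPDFReal 0 v x)
    (fun x _ => hf x) (fun x _ => hasDerivAt_gaussianPDFReal_zero hv x) ?_ ?_ ?_
  · simp only [smul_eq_mul]
    have e1 : ∫ x, gaussianPDFReal 0 v x * (x * f x) =
        -v * ∫ x, f x * (-(x / v) * gaussianPDFReal 0 v x) := by
      rw [← integral_const_mul]
      congr 1; ext x; field_simp
    rw [e1, key]
    have : ∀ x, f' x * gaussianPDFReal 0 v x = gaussianPDFReal 0 v x * f' x :=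
      fun x => mul_comm _ _
    simp [this]
  · have : (fun x => f x * (-(x / v) * gaussianPDFReal 0 v x)) =
        fun x => f x * (-(1 / v) * (gaussianPDFReal 0 v x * x)) := by
      ext x; ring
    change Integrable (fun x => f x * (-(x / v) * gaussianPDFReal 0 v x)) volume
    rw [this]
    exact (hid'.const_mul _).bdd_mul hfm.aestronglyMeasurable (ae_of_all _ hC)
  · exact hpdf.bdd_mul hfm'.aestronglyMeasurable (ae_of_all _ hC')
  · exact hpdf.bdd_mul hfm.aestronglyMeasurable (ae_of_all _ hC)

/-- Integration by parts against a centered Gaussian variable `W`, conditionally on an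
independent variable `R`. -/
lemma integral_mul_eq_of_indepFun {Ω E : Type*} [MeasurableSpace Ω] [MeasurableSpace E]
    {P : Measure Ω} [IsProbabilityMeasure P] {W : Ω → ℝ} {R : Ω → E} {v : ℝ≥0}
    (hW : P.map W = gaussianReal 0 v) (hWm : AEMeasurable W P) (hRm : AEMeasurable R P)
    (hind : IndepFun W R P) {f f' : ℝ → E → ℝ} {C C' : ℝ}
    (hfm : Measurable (Function.uncurry f)) (hfm' : Measurable (Function.uncurry f'))
    (hf : ∀ x r, HasDerivAt (fun x => f x r) (f' x r) x)
    (hC : ∀ x r, |f x r| ≤ C) (hC' : ∀ x r, |f' x r| ≤ C') :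
    ∫ ω, W ω * f (W ω) (R ω) ∂P = v * ∫ ω, f' (W ω) (R ω) ∂P := by
  have hlaw := (indepFun_iff_map_prod_eq_prod_map_map hWm hRm).1 hind
  have hpair : AEMeasurable (fun ω => (W ω, R ω)) P := hWm.prodMk hRm
  have : IsProbabilityMeasure (P.map R) := Measure.isProbabilityMeasure_map hRm
  have hid : Integrable (fun x : ℝ => x) (gaussianReal 0 v) :=
    (memLp_id_gaussianReal 1).integrable (by norm_num)
  have e1 : ∫ ω, W ω * f (W ω) (R ω) ∂P =
      ∫ p, p.1 * f p.1 p.2 ∂((gaussianReal 0 v).prod (P.map R)) := by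
    rw [← hW, ← hlaw, integral_map hpair]
    exact (measurable_fst.mul hfm).aestronglyMeasurable
  have e2 : ∫ ω, f' (W ω) (R ω) ∂P =
      ∫ p, f' p.1 p.2 ∂((gaussianReal 0 v).prod (P.map R)) := by
    rw [← hW, ← hlaw, integral_map hpair]
    exact hfm'.aestronglyMeasurable
  rw [e1, e2, integral_prod_symm, integral_prod_symm, ← integral_const_mul]
  · congr 1; ext r
    exact integral_mul_gaussianReal_eq (hf · r) (hC · r) (hC' · r)
  · exact Integrable.of_bound hfm'.aestronglyMeasurable C' (ae_of_all _ fun p => hC' p.1 p.2)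
  · have : Integrable (fun p : ℝ × E => p.1) ((gaussianReal 0 v).prod (P.map R)) :=
      hid.comp_fst _
    exact this.mul_bdd hfm.aestronglyMeasurable (ae_of_all _ fun p => hC p.1 p.2)

/-- If `(W, Z)` is jointly Gaussian with `W` centered and uncorrelated with `Z i`, the expectation
of `W` against `G i'` and the other `G j` is controlled by the covariances of `W` with `Z`. -/
lemma abs_integral_mul_prod_le {Ω ι : Type*} [MeasurableSpace Ω] [Fintype ι]
    {P : Measure Ω} [IsProbabilityMeasure P] {W : Ω → ℝ} {Z : ι → Ω → ℝ}
    (hWZ : HasGaussianLaw (fun ω => (W ω, fun j => Z j ω)) P) (hW0 : ∫ ω, W ω ∂P = 0)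
    {i : ι} (hi : cov[W, Z i; P] = 0) {G G' : ι → ℝ → ℝ} {C : ℝ}
    (hG : ∀ j x, HasDerivAt (G j) (G' j x) x) (hG1 : ∀ j x, |G j x| ≤ 1)
    (hG' : ∀ j x, |G' j x| ≤ C) :
    |∫ ω, W ω * (G' i (Z i ω) * ∏ j ∈ Finset.univ.erase i, G j (Z j ω)) ∂P| ≤
      ∑ j ∈ Finset.univ.erase i, |cov[W, Z j; P]| * ∫ ω, |G' i (Z i ω)| * |G' j (Z j ω)| ∂P := by
  have hC : 0 ≤ C := (abs_nonneg _).trans (hG' i 0)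
  have hGm : ∀ j, Measurable (G j) := fun j =>
    (continuous_iff_continuousAt.2 fun x => (hG j x).continuousAt).measurable
  have hGm' : ∀ j, Measurable (G' j) := fun j => by
    have : G' j = deriv (G j) := funext fun x => (hG j x).deriv.symm
    exact this ▸ measurable_deriv (G j)
  have hWg : HasGaussianLaw W P := hWZ.fst
  have hZg : ∀ j, HasGaussianLaw (Z j) P := fun j => hWZ.snd.eval j
  have hZm : ∀ j, AEMeasurable (Z j) P := fun j => (hZg j).aemeasurable
  set v : ℝ≥0 := Var[W; P].toNNReal with hv
  have hWlaw : P.map W = gaussianReal 0 v := by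
    rw [hWg.map_eq_gaussianReal, hW0]
  have hvv : (v : ℝ) = Var[W; P] := Real.coe_toNNReal _ (variance_nonneg _ _)
  by_cases hv0 : v = 0
  · have hW_ae : ∀ᵐ ω ∂P, W ω = 0 := by
      have h1 : ∀ᵐ x ∂(P.map W), x = 0 := by
        rw [hWlaw, hv0, gaussianReal_zero_var, ae_dirac_eq]; exact rfl
      exact ae_of_ae_map hWg.aemeasurable h1
    have : ∫ ω, W ω * (G' i (Z i ω) * ∏ j ∈ Finset.univ.erase i, G j (Z j ω)) ∂P = 0 :=
      integral_eq_zero_of_ae (hW_ae.mono fun ω h => by simp [h])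
    rw [this, abs_zero]
    exact Finset.sum_nonneg fun j _ => mul_nonneg (abs_nonneg _)
      (integral_nonneg fun ω => by positivity)
  have hv' : (v : ℝ) ≠ 0 := by exact_mod_cast hv0
  set κ : ι → ℝ := fun j => cov[W, Z j; P] / v with hκ
  have hκi : κ i = 0 := by simp [hκ, hi]
  set R : Ω → ι → ℝ := fun ω j => Z j ω - κ j * W ω with hR
  have hind : IndepFun W R P := by
    let L : ℝ × (ι → ℝ) →L[ℝ] (Unit → ℝ) × (ι → ℝ) :=
      (ContinuousLinearMap.pi fun _ => ContinuousLinearMap.fst ℝ ℝ (ι → ℝ)).prod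
        (ContinuousLinearMap.pi fun j =>
          (ContinuousLinearMap.proj j).comp (ContinuousLinearMap.snd ℝ ℝ (ι → ℝ)) -
            κ j • ContinuousLinearMap.fst ℝ ℝ (ι → ℝ))
    have h1 : HasGaussianLaw (fun ω => (fun _ : Unit => W ω, fun j => Z j ω - κ j * W ω)) P := by
      have := hWZ.map_fun L
      simpa [L] using this
    have h2 := h1.indepFun_of_covariance_eval (X := fun _ : Unit => W)
      (Y := fun j ω => Z j ω - κ j * W ω) (fun _ j => by
        rw [covariance_fun_sub_right hWg.memLp_two (hZg j).memLp_two
          (hWg.memLp_two.const_mul _), covariance_const_mul_right,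
          covariance_self hWg.aemeasurable, ← hvv]
        simp only [hκ]
        field_simp
        ring)
    exact h2.comp (φ := fun x : Unit → ℝ => x ()) (ψ := id) (measurable_pi_apply _) measurable_id
  have hRm : AEMeasurable R P := by
    refine aemeasurable_pi_lambda _ fun j => (hZm j).sub (hWg.aemeasurable.const_mul _)
  set s := (Finset.univ : Finset ι).erase i with hs
  set f : ℝ → (ι → ℝ) → ℝ := fun x r => G' i (r i) * ∏ j ∈ s, G j (r j + κ j * x) with hf
  set f' : ℝ → (ι → ℝ) → ℝ := fun x r => G' i (r i) *
    ∑ j ∈ s, (∏ l ∈ s.erase j, G l (r l + κ l * x)) • (G' j (r j + κ j * x) * κ j) with hf'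
  have hprod : ∀ (t : Finset ι) (y : ι → ℝ), |∏ j ∈ t, G j (y j)| ≤ 1 := fun t y => by
    rw [Finset.abs_prod]
    exact Finset.prod_le_one (fun _ _ => abs_nonneg _) fun j _ => hG1 j _
  have marg : ∀ j, Measurable fun p : ℝ × (ι → ℝ) => p.2 j + κ j * p.1 := fun j => by fun_prop
  have key := integral_mul_eq_of_indepFun (f := f) (f' := f') (C := C)
    (C' := C * ∑ j ∈ s, C * |κ j|) hWlaw hWg.aemeasurable hRm hind ?_ ?_ ?_ ?_ ?_
  rotate_left
  · refine ((hGm' i).comp (by fun_prop)).mul (Finset.measurable_prod _ fun j _ => ?_)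
    exact (hGm j).comp (marg j)
  · refine ((hGm' i).comp (by fun_prop)).mul (Finset.measurable_sum _ fun j _ => ?_)
    refine (Finset.measurable_prod _ fun l _ => (hGm l).comp (marg l)).mul ?_
    exact ((hGm' j).comp (marg j)).mul_const _
  · intro x r
    refine HasDerivAt.const_mul _ ?_
    refine HasDerivAt.fun_finsetProd fun j _ => ?_
    refine (hG j _).comp x ?_
    simpa using ((hasDerivAt_id x).const_mul (κ j)).const_add (r j)
  · intro x r
    rw [hf, abs_mul]
    calc _ ≤ C * 1 := mul_le_mul (hG' _ _) (hprod s fun j => r j + κ j * x) (abs_nonneg _) hC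
      _ = C := mul_one C
  · intro x r
    rw [hf', abs_mul]
    refine mul_le_mul (hG' _ _) ?_ (abs_nonneg _) hC
    refine (Finset.abs_sum_le_sum_abs _ _).trans (Finset.sum_le_sum fun j _ => ?_)
    rw [smul_eq_mul, abs_mul, abs_mul]
    calc _ ≤ 1 * (C * |κ j|) := mul_le_mul (hprod _ fun l => r l + κ l * x)
          (mul_le_mul_of_nonneg_right (hG' _ _) (abs_nonneg _)) (by positivity) zero_le_one
      _ = _ := one_mul _
  have e0 : ∀ ω j, R ω j + κ j * W ω = Z j ω := fun ω j => by simp [hR]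
  have e0i : ∀ ω, R ω i = Z i ω := fun ω => by simp [hR, hκi]
  simp only [hf, hf', e0, e0i] at key
  rw [key]
  have hmt : ∀ j, AEStronglyMeasurable (fun ω => |G' i (Z i ω)| * |G' j (Z j ω)|) P := fun j =>
    ((((hGm' i).comp_aemeasurable (hZm i)).norm).mul
      (((hGm' j).comp_aemeasurable (hZm j)).norm)).aestronglyMeasurable
  have hint : ∀ j, Integrable (fun ω => |G' i (Z i ω)| * |G' j (Z j ω)|) P := fun j => by
    refine Integrable.of_bound (hmt j) (C * C) (ae_of_all _ fun ω => ?_)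
    rw [norm_mul, norm_eq_abs, norm_eq_abs, abs_abs, abs_abs]
    exact mul_le_mul (hG' _ _) (hG' _ _) (abs_nonneg _) hC
  rw [abs_mul, abs_of_nonneg v.coe_nonneg]
  calc _ ≤ v * ∫ ω, ∑ j ∈ s, |κ j| * (|G' i (Z i ω)| * |G' j (Z j ω)|) ∂P := by
        refine mul_le_mul_of_nonneg_left ?_ v.coe_nonneg
        refine abs_integral_le_integral_abs.trans ?_
        refine integral_mono_of_nonneg (ae_of_all _ fun _ => abs_nonneg _)
          (integrable_finsetSum _ fun j _ => (hint j).const_mul _) (ae_of_all _ fun ω => ?_)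
        simp only
        rw [abs_mul]
        refine (mul_le_mul_of_nonneg_left (Finset.abs_sum_le_sum_abs _ _) (abs_nonneg _)).trans ?_
        rw [Finset.mul_sum]
        refine Finset.sum_le_sum fun j _ => ?_
        rw [smul_eq_mul, abs_mul, abs_mul]
        have h1 := hprod (s.erase j) fun l => Z l ω
        calc _ ≤ |G' i (Z i ω)| * (1 * (|G' j (Z j ω)| * |κ j|)) := by gcongr
          _ = _ := by ring
    _ = _ := by
        rw [integral_finsetSum _ fun j _ => (hint j).const_mul _, Finset.mul_sum]
        refine Finset.sum_congr rfl fun j _ => ?_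
        rw [integral_const_mul, hκ, abs_div, abs_of_nonneg v.coe_nonneg]
        field_simp

lemma covariance_rotation {Ω : Type*} [MeasurableSpace Ω] {P : Measure Ω} [IsProbabilityMeasure P]
    {X X' Y Y' : Ω → ℝ} (hX : MemLp X 2 P) (hX' : MemLp X' 2 P) (hY : MemLp Y 2 P)
    (hY' : MemLp Y' 2 P) (h1 : cov[X, Y'; P] = 0) (h2 : cov[Y, X'; P] = 0) (a b c d : ℝ) :
    cov[fun ω => a * X ω + b * Y ω, fun ω => c * X' ω + d * Y' ω; P] =
      a * c * cov[X, X'; P] + b * d * cov[Y, Y'; P] := by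
  change cov[(fun ω => a * X ω) + (fun ω => b * Y ω), (fun ω => c * X' ω) + (fun ω => d * Y' ω); P]
    = _
  rw [covariance_add_left (hX.const_mul _) (hY.const_mul _)
      ((hX'.const_mul _).add (hY'.const_mul _)),
    covariance_add_right (hX.const_mul _) (hX'.const_mul _) (hY'.const_mul _),
    covariance_add_right (hY.const_mul _) (hX'.const_mul _) (hY'.const_mul _)]
  simp only [covariance_const_mul_left, covariance_const_mul_right, h1, h2]
  ring

lemma hasGaussianLaw_rotation {Ω ι : Type*} [MeasurableSpace Ω] [Fintype ι]
    {P : Measure Ω} {X Y : ι → Ω → ℝ}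
    (hXY : HasGaussianLaw (fun ω => (fun i => X i ω, fun i => Y i ω)) P) (i : ι) (a b c d : ℝ) :
    HasGaussianLaw (fun ω => (a * X i ω + b * Y i ω, fun j => c * X j ω + d * Y j ω)) P := by
  let F := ContinuousLinearMap.fst ℝ (ι → ℝ) (ι → ℝ)
  let S := ContinuousLinearMap.snd ℝ (ι → ℝ) (ι → ℝ)
  let p : ι → (ι → ℝ) →L[ℝ] ℝ := fun j => ContinuousLinearMap.proj j
  let L : (ι → ℝ) × (ι → ℝ) →L[ℝ] ℝ × (ι → ℝ) :=
    (a • (p i).comp F + b • (p i).comp S).prod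
      (ContinuousLinearMap.pi fun j => c • (p j).comp F + d • (p j).comp S)
  simpa [L, F, S, p] using hXY.map_fun L

/-- Comparison of the expectations of a product of smooth functions under two Gaussian vectors
with the same variances, by Gaussian interpolation. -/
lemma abs_integral_prod_sub_integral_prod_le {Ω ι : Type*} [MeasurableSpace Ω] [Fintype ι]
    {P : Measure Ω} [IsProbabilityMeasure P] {X Y : ι → Ω → ℝ}
    (hXY : HasGaussianLaw (fun ω => (fun i => X i ω, fun i => Y i ω)) P)
    (hX0 : ∀ i, ∫ ω, X i ω ∂P = 0) (hY0 : ∀ i, ∫ ω, Y i ω ∂P = 0)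
    (hcov : ∀ i j, cov[X i, Y j; P] = 0) (hvar : ∀ i, cov[X i, X i; P] = cov[Y i, Y i; P])
    {G G' : ι → ℝ → ℝ} {C : ℝ} (hG : ∀ j x, HasDerivAt (G j) (G' j x) x)
    (hG1 : ∀ j x, |G j x| ≤ 1) (hG' : ∀ j x, |G' j x| ≤ C) {B : ι → ι → ℝ}
    (hB : ∀ i j, i ≠ j → ∀ θ : ℝ, ∫ ω, |G' i (sin θ * X i ω + cos θ * Y i ω)| *
      |G' j (sin θ * X j ω + cos θ * Y j ω)| ∂P ≤ B i j) :
    |∫ ω, ∏ i, G i (X i ω) ∂P - ∫ ω, ∏ i, G i (Y i ω) ∂P| ≤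
      π / 2 * ∑ i, ∑ j ∈ Finset.univ.erase i, |cov[X i, X j; P] - cov[Y i, Y j; P]| * B i j := by
  have hGm : ∀ j, Measurable (G j) := fun j =>
    (continuous_iff_continuousAt.2 fun x => (hG j x).continuousAt).measurable
  have hGm' : ∀ j, Measurable (G' j) := fun j => by
    have : G' j = deriv (G j) := funext fun x => (hG j x).deriv.symm
    exact this ▸ measurable_deriv (G j)
  have hXg : ∀ i, HasGaussianLaw (X i) P := fun i => hXY.fst.eval i
  have hYg : ∀ i, HasGaussianLaw (Y i) P := fun i => hXY.snd.eval i
  have hXi : ∀ i, Integrable (X i) P := fun i => (hXg i).integrable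
  have hYi : ∀ i, Integrable (Y i) P := fun i => (hYg i).integrable
  have hprod : ∀ (t : Finset ι) (y : ι → ℝ), |∏ j ∈ t, G j (y j)| ≤ 1 := fun t y => by
    rw [Finset.abs_prod]
    exact Finset.prod_le_one (fun _ _ => abs_nonneg _) fun j _ => hG1 j _
  set Z : ℝ → ι → Ω → ℝ := fun θ i ω => sin θ * X i ω + cos θ * Y i ω with hZ
  set W : ℝ → ι → Ω → ℝ := fun θ i ω => cos θ * X i ω + -sin θ * Y i ω with hW
  have hZm : ∀ θ i, AEMeasurable (Z θ i) P := fun θ i =>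
    ((hXg i).aemeasurable.const_mul _).add ((hYg i).aemeasurable.const_mul _)
  have hWm : ∀ θ i, AEMeasurable (W θ i) P := fun θ i =>
    ((hXg i).aemeasurable.const_mul _).add ((hYg i).aemeasurable.const_mul _)
  set F' : ℝ → Ω → ℝ := fun θ ω => ∑ i, (∏ j ∈ Finset.univ.erase i, G j (Z θ j ω)) •
    (G' i (Z θ i ω) * W θ i ω) with hF'
  have hFm : ∀ θ, AEStronglyMeasurable (fun ω => ∏ i, G i (Z θ i ω)) P := fun θ =>
    (Finset.aemeasurable_fun_prod _ fun i _ =>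
      (hGm i).comp_aemeasurable (hZm θ i)).aestronglyMeasurable
  have hWb : ∀ θ i ω, |W θ i ω| ≤ |X i ω| + |Y i ω| := fun θ i ω => by
    refine (abs_add_le _ _).trans (add_le_add ?_ ?_)
    · rw [abs_mul]; exact mul_le_of_le_one_left (abs_nonneg _) (abs_cos_le_one θ)
    · rw [abs_mul, abs_neg]; exact mul_le_of_le_one_left (abs_nonneg _) (abs_sin_le_one θ)
  have hT : ∀ θ i ω, |(∏ j ∈ Finset.univ.erase i, G j (Z θ j ω)) • (G' i (Z θ i ω) * W θ i ω)| ≤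
      C * (|X i ω| + |Y i ω|) := fun θ i ω => by
    rw [smul_eq_mul, abs_mul, abs_mul]
    have h1 := hprod (Finset.univ.erase i) fun j => Z θ j ω
    have h2 := hG' i (Z θ i ω)
    have h3 := hWb θ i ω
    have h4 : 0 ≤ C := (abs_nonneg _).trans h2
    calc _ ≤ 1 * (C * (|X i ω| + |Y i ω|)) := by gcongr
      _ = _ := one_mul _
  have hTm : ∀ θ i, AEStronglyMeasurable (fun ω => (∏ j ∈ Finset.univ.erase i, G j (Z θ j ω)) •
      (G' i (Z θ i ω) * W θ i ω)) P := fun θ i =>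
    ((Finset.aemeasurable_fun_prod _ fun j _ => (hGm j).comp_aemeasurable (hZm θ j)).mul
      (((hGm' i).comp_aemeasurable (hZm θ i)).mul (hWm θ i))).aestronglyMeasurable
  have hbi : ∀ i, Integrable (fun ω => C * (|X i ω| + |Y i ω|)) P := fun i =>
    ((hXi i).abs.add (hYi i).abs).const_mul C
  have hTi : ∀ θ i, Integrable (fun ω => (∏ j ∈ Finset.univ.erase i, G j (Z θ j ω)) •
      (G' i (Z θ i ω) * W θ i ω)) P := fun θ i =>
    (hbi i).mono' (hTm θ i) (ae_of_all _ (hT θ i))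
  have hderiv : ∀ θ, HasDerivAt (fun θ => ∫ ω, ∏ i, G i (Z θ i ω) ∂P) (∫ ω, F' θ ω ∂P) θ := by
    intro θ
    refine (hasDerivAt_integral_of_dominated_loc_of_deriv_le (s := Set.univ)
      (bound := fun ω => ∑ i, C * (|X i ω| + |Y i ω|)) univ_mem
      (Eventually.of_forall hFm) ?_ ?_ ?_ ?_ ?_).2
    · exact Integrable.of_bound (hFm θ) 1 (ae_of_all _ fun ω => hprod _ fun i => Z θ i ω)
    · exact Finset.aestronglyMeasurable_fun_sum _ fun i _ => hTm θ i
    · refine ae_of_all _ fun ω φ _ => ?_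
      exact (Finset.abs_sum_le_sum_abs _ _).trans (Finset.sum_le_sum fun i _ => hT φ i ω)
    · exact integrable_finsetSum _ fun i _ => hbi i
    · refine ae_of_all _ fun ω φ _ => ?_
      refine HasDerivAt.fun_finsetProd fun i _ => ?_
      refine (hG i _).comp φ ?_
      exact ((hasDerivAt_sin φ).mul_const _).add ((hasDerivAt_cos φ).mul_const _)
  have hbound : ∀ θ, ‖∫ ω, F' θ ω ∂P‖ ≤
      ∑ i, ∑ j ∈ Finset.univ.erase i, |cov[X i, X j; P] - cov[Y i, Y j; P]| * B i j := by
    intro θ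
    simp only [hF']
    rw [integral_finsetSum _ fun i _ => hTi θ i]
    refine (norm_sum_le _ _).trans (Finset.sum_le_sum fun i _ => ?_)
    have hc : ∀ j, cov[W θ i, Z θ j; P] =
        sin θ * cos θ * (cov[X i, X j; P] - cov[Y i, Y j; P]) := fun j => by
      rw [hW, hZ]
      simp only
      rw [covariance_rotation (hXg i).memLp_two (hXg j).memLp_two (hYg i).memLp_two
        (hYg j).memLp_two (hcov i j) (by rw [covariance_comm]; exact hcov j i)]
      ring
    have h := abs_integral_mul_prod_le (W := W θ i) (Z := Z θ) (i := i)
      (hasGaussianLaw_rotation hXY i (cos θ) (-sin θ) (sin θ) (cos θ)) (by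
        simp only [hW]
        rw [integral_add ((hXi i).const_mul _) ((hYi i).const_mul _), integral_const_mul,
          integral_const_mul, hX0, hY0]
        ring) (by rw [hc, hvar]; ring) hG hG1 hG'
    have e : ∫ ω, (∏ j ∈ Finset.univ.erase i, G j (Z θ j ω)) • (G' i (Z θ i ω) * W θ i ω) ∂P =
        ∫ ω, W θ i ω * (G' i (Z θ i ω) * ∏ j ∈ Finset.univ.erase i, G j (Z θ j ω)) ∂P := by
      congr 1; ext ω; rw [smul_eq_mul]; ring
    rw [e]
    refine h.trans (Finset.sum_le_sum fun j hj => ?_)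
    rw [hc]
    refine mul_le_mul ?_ (hB i j (Finset.ne_of_mem_erase hj).symm θ)
      (integral_nonneg fun ω => by positivity) (abs_nonneg _)
    rw [abs_mul, abs_mul]
    refine mul_le_of_le_one_left (abs_nonneg _) ?_
    exact mul_le_one₀ (abs_sin_le_one θ) (abs_nonneg _) (abs_cos_le_one θ)
  have := (convex_Icc (0 : ℝ) (π / 2)).norm_image_sub_le_of_norm_hasDerivWithin_le
    (fun θ _ => (hderiv θ).hasDerivWithinAt) (fun θ _ => hbound θ)
    (Set.left_mem_Icc.2 (by positivity)) (Set.right_mem_Icc.2 (by positivity))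
  simp only [hZ, sin_pi_div_two, cos_pi_div_two, sin_zero, cos_zero, one_mul, zero_mul, add_zero,
    zero_add, sub_zero, norm_eq_abs] at this
  rw [abs_of_nonneg (by positivity : (0 : ℝ) ≤ π / 2)] at this
  rwa [mul_comm]

/-- A bound for the standard bivariate Gaussian density with correlation `c` on `[u, ∞)²`. -/
lemma gaussianPDFReal_mul_gaussianPDFReal_le {c w δ u a b : ℝ} (hc : |c| ≤ w) (hw : w ≤ δ)
    (hδ : δ < 1) (hu : 0 ≤ u) (ha : u ≤ a) (hb : u ≤ b) :
    gaussianPDFReal 0 1 a * gaussianPDFReal (c * a) (1 - c ^ 2).toNNReal b ≤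
      (2 * π * √(1 - δ ^ 2))⁻¹ * exp (-(u ^ 2 / (1 + w))) := by
  have h0 := abs_nonneg c
  have hc1 : |c| < 1 := by linarith
  have hc2 : c ^ 2 = |c| ^ 2 := (sq_abs c).symm
  have hcd : c ^ 2 ≤ δ ^ 2 := by rw [hc2]; gcongr; linarith
  have hd1 : 0 < 1 - δ ^ 2 := by nlinarith
  have hs : 0 < 1 - c ^ 2 := by linarith
  have e1 : ((1 - c ^ 2).toNNReal : ℝ) = 1 - c ^ 2 := Real.coe_toNNReal _ hs.le
  rw [gaussianPDFReal, gaussianPDFReal, e1]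
  simp only [NNReal.coe_one, mul_one, sub_zero]
  have e2 : (√(2 * π))⁻¹ * (√(2 * π * (1 - c ^ 2)))⁻¹ = (2 * π * √(1 - c ^ 2))⁻¹ := by
    rw [sqrt_mul (by positivity : (0 : ℝ) ≤ 2 * π) (1 - c ^ 2), ← mul_inv, ← mul_assoc,
      mul_self_sqrt (by positivity)]
  have e3 : (√(2 * π))⁻¹ * exp (-a ^ 2 / 2) *
      ((√(2 * π * (1 - c ^ 2)))⁻¹ * exp (-(b - c * a) ^ 2 / (2 * (1 - c ^ 2)))) =
      (2 * π * √(1 - c ^ 2))⁻¹ *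
        exp (-a ^ 2 / 2 + -(b - c * a) ^ 2 / (2 * (1 - c ^ 2))) := by
    rw [exp_add, ← e2]; ring
  rw [e3]
  have hsd : 0 < √(1 - δ ^ 2) := sqrt_pos.2 hd1
  have hexp : -a ^ 2 / 2 + -(b - c * a) ^ 2 / (2 * (1 - c ^ 2)) ≤ -(u ^ 2 / (1 + w)) := by
    have q1 : -a ^ 2 / 2 + -(b - c * a) ^ 2 / (2 * (1 - c ^ 2)) =
        -((a ^ 2 + b ^ 2 - 2 * c * a * b) / (2 * (1 - c ^ 2))) := by
      field_simp; ring
    have q2 : u ^ 2 / (1 + w) ≤ u ^ 2 / (1 + |c|) := by gcongr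
    have q3 : u ^ 2 / (1 + |c|) ≤ (a ^ 2 + b ^ 2 - 2 * c * a * b) / (2 * (1 - c ^ 2)) := by
      have hf : 1 - c ^ 2 = (1 - |c|) * (1 + |c|) := by rw [hc2]; ring
      rw [div_le_div_iff₀ (by positivity) (by positivity), hf]
      have hab : 0 ≤ a * b := mul_nonneg (hu.trans ha) (hu.trans hb)
      have huu : u ^ 2 ≤ a * b := by nlinarith
      have : 2 * (1 - |c|) * u ^ 2 ≤ a ^ 2 + b ^ 2 - 2 * c * a * b := by
        have := le_abs_self c
        nlinarith [sq_nonneg (a - b), mul_nonneg hab (sub_nonneg.2 this),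
          mul_nonneg (sub_nonneg.2 huu) (sub_nonneg.2 hc1.le)]
      nlinarith
    rw [q1]
    linarith
  gcongr

lemma integral_mul_le_of_hasGaussianLaw {Ω : Type*} [MeasurableSpace Ω]
    {P : Measure Ω} [IsProbabilityMeasure P] {Z₁ Z₂ : Ω → ℝ}
    (hZ : HasGaussianLaw (fun ω => (Z₁ ω, Z₂ ω)) P) (h1 : ∫ ω, Z₁ ω ∂P = 0)
    (h2 : ∫ ω, Z₂ ω ∂P = 0) (hv1 : cov[Z₁, Z₁; P] = 1) (hv2 : cov[Z₂, Z₂; P] = 1)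
    {w δ u : ℝ} (hw : |cov[Z₁, Z₂; P]| ≤ w) (hwδ : w ≤ δ) (hδ : δ < 1) (hu : 0 ≤ u)
    {f g : ℝ → ℝ} {M : ℝ} (hf0 : ∀ x, 0 ≤ f x) (hg0 : ∀ x, 0 ≤ g x) (hfM : ∀ x, f x ≤ M)
    (hgM : ∀ x, g x ≤ M) (hfu : ∀ x < u, f x = 0) (hgu : ∀ x < u, g x = 0)
    (hf : Integrable f) (hg : Integrable g) (hfm : Measurable f) (hgm : Measurable g) :
    ∫ ω, f (Z₁ ω) * g (Z₂ ω) ∂P ≤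
      (2 * π * √(1 - δ ^ 2))⁻¹ * exp (-(u ^ 2 / (1 + w))) * ((∫ x, f x) * ∫ x, g x) := by
  set c := cov[Z₁, Z₂; P] with hc
  have hZ1 := hZ.fst
  have hZ2 := hZ.snd
  have hc1 : |c| < 1 := by linarith
  have hs : 0 < 1 - c ^ 2 := by
    have : c ^ 2 = |c| ^ 2 := (sq_abs c).symm
    have := abs_nonneg c
    nlinarith
  have hv : (1 - c ^ 2).toNNReal ≠ 0 := by simpa using hs
  have hM : 0 ≤ M := (hf0 0).trans (hfM 0)
  set R : Ω → ℝ := fun ω => Z₂ ω - c * Z₁ ω with hR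
  have hZR : HasGaussianLaw (fun ω => (Z₁ ω, R ω)) P := by
    let L : ℝ × ℝ →L[ℝ] ℝ × ℝ := (ContinuousLinearMap.fst ℝ ℝ ℝ).prod
      (ContinuousLinearMap.snd ℝ ℝ ℝ - c • ContinuousLinearMap.fst ℝ ℝ ℝ)
    simpa [L] using hZ.map_fun L
  have hcovR : cov[Z₁, R; P] = 0 := by
    rw [hR, covariance_fun_sub_right hZ1.memLp_two hZ2.memLp_two (hZ1.memLp_two.const_mul _),
      covariance_const_mul_right, hv1]
    simp [hc]
  have hind : IndepFun Z₁ R P := hZR.indepFun_of_covariance_eq_zero hcovR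
  have hvarR : Var[R; P] = 1 - c ^ 2 := by
    rw [← covariance_self hZR.snd.aemeasurable]
    nth_rewrite 1 [hR]
    rw [covariance_fun_sub_left hZ2.memLp_two (hZ1.memLp_two.const_mul _) hZR.snd.memLp_two,
      covariance_const_mul_left, hcovR, hR,
      covariance_fun_sub_right hZ2.memLp_two hZ2.memLp_two (hZ1.memLp_two.const_mul _),
      covariance_const_mul_right, hv2, covariance_comm Z₂ Z₁]
    ring
  have hR0 : ∫ ω, R ω ∂P = 0 := by
    rw [hR, integral_sub hZ2.integrable (hZ1.integrable.const_mul _), integral_const_mul, h1, h2]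
    ring
  have hlaw1 : P.map Z₁ = gaussianReal 0 1 := by
    rw [hZ1.map_eq_gaussianReal, h1, ← covariance_self hZ1.aemeasurable, hv1]; simp
  have hlawR : P.map R = gaussianReal 0 (1 - c ^ 2).toNNReal := by
    rw [hZR.snd.map_eq_gaussianReal, hR0, hvarR]
  have hlaw := (indepFun_iff_map_prod_eq_prod_map_map hZ1.aemeasurable hZR.snd.aemeasurable).1 hind
  rw [hlaw1, hlawR] at hlaw
  have hmeas : Measurable fun p : ℝ × ℝ => f p.1 * g (p.2 + c * p.1) :=
    (hfm.comp measurable_fst).mul (hgm.comp (by fun_prop))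
  have hb : ∀ p : ℝ × ℝ, ‖f p.1 * g (p.2 + c * p.1)‖ ≤ M * M := fun p => by
    rw [norm_eq_abs, abs_of_nonneg (mul_nonneg (hf0 _) (hg0 _))]
    exact mul_le_mul (hfM _) (hgM _) (hg0 _) hM
  have e1 : ∫ ω, f (Z₁ ω) * g (Z₂ ω) ∂P = ∫ p, f p.1 * g (p.2 + c * p.1)
      ∂((gaussianReal 0 1).prod (gaussianReal 0 (1 - c ^ 2).toNNReal)) := by
    rw [← hlaw, integral_map (hZ1.aemeasurable.prodMk hZR.snd.aemeasurable)
      hmeas.aestronglyMeasurable]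
    congr 1; ext ω; simp [hR]
  rw [e1, integral_prod _ (Integrable.of_bound hmeas.aestronglyMeasurable _ (ae_of_all _ hb)),
    integral_gaussianReal_eq_integral_smul one_ne_zero]
  set K := (2 * π * √(1 - δ ^ 2))⁻¹ * exp (-(u ^ 2 / (1 + w))) with hK
  have hK0 : 0 ≤ K := by positivity
  have hI : 0 ≤ ∫ x, g x := integral_nonneg hg0
  rw [show K * ((∫ x, f x) * ∫ x, g x) = ∫ a, f a * (K * ∫ x, g x) by
    rw [integral_mul_const]; ring]
  refine integral_mono_of_nonneg (ae_of_all _ fun a => ?_) (hf.mul_const _)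
    (ae_of_all _ fun a => ?_)
  · exact smul_nonneg (gaussianPDFReal_nonneg _ _ _)
      (integral_nonneg fun b => mul_nonneg (hf0 _) (hg0 _))
  · simp only [smul_eq_mul]
    rw [integral_const_mul]
    by_cases ha : a < u
    · simp [hfu a ha]
    have e2 : ∫ b, g (b + c * a) ∂gaussianReal 0 (1 - c ^ 2).toNNReal =
        ∫ b, gaussianPDFReal (c * a) (1 - c ^ 2).toNNReal b * g b := by
      rw [← integral_map (φ := fun b => b + c * a) (by fun_prop) hgm.aestronglyMeasurable,
        gaussianReal_map_add_const, zero_add, integral_gaussianReal_eq_integral_smul hv]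
      rfl
    have e3 : gaussianPDFReal 0 1 a * (f a * ∫ b, g (b + c * a)
        ∂gaussianReal 0 (1 - c ^ 2).toNNReal) =
        f a * ∫ b, gaussianPDFReal 0 1 a *
          (gaussianPDFReal (c * a) (1 - c ^ 2).toNNReal b * g b) := by
      rw [e2, integral_const_mul]; ring
    rw [e3]
    refine mul_le_mul_of_nonneg_left ?_ (hf0 a)
    rw [← integral_const_mul K]
    refine integral_mono_of_nonneg (ae_of_all _ fun b => ?_) (hg.const_mul _)
      (ae_of_all _ fun b => ?_)
    · exact mul_nonneg (gaussianPDFReal_nonneg _ _ _)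
        (mul_nonneg (gaussianPDFReal_nonneg _ _ _) (hg0 b))
    · by_cases hbu : b < u
      · simp [hgu b hbu]
      · simp only
        rw [← mul_assoc]
        exact mul_le_mul_of_nonneg_right
          (gaussianPDFReal_mul_gaussianPDFReal_le hw hwδ hδ hu (not_lt.1 ha) (not_lt.1 hbu)) (hg0 b)

lemma hasCompactSupport_deriv_smoothTransition :
    HasCompactSupport (deriv Real.smoothTransition) := by
  refine HasCompactSupport.intro (isCompact_Icc (a := (0 : ℝ)) (b := 1)) fun x hx => ?_
  rw [Set.mem_Icc, not_and_or, not_le, not_le] at hx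
  rcases hx with hx | hx
  · have : Real.smoothTransition =ᶠ[nhds x] fun _ => 0 := by
      filter_upwards [Iio_mem_nhds hx] with y hy
      exact Real.smoothTransition.zero_of_nonpos (le_of_lt hy)
    rw [this.deriv_eq, deriv_const]
  · have : Real.smoothTransition =ᶠ[nhds x] fun _ => 1 := by
      filter_upwards [Ioi_mem_nhds hx] with y hy
      exact Real.smoothTransition.one_of_one_le (le_of_lt hy)
    rw [this.deriv_eq, deriv_const]

lemma continuous_deriv_smoothTransition : Continuous (deriv Real.smoothTransition) :=
  (Real.smoothTransition.contDiff (n := 1)).continuous_deriv le_rfl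

lemma integrable_deriv_smoothTransition : Integrable (deriv Real.smoothTransition) :=
  continuous_deriv_smoothTransition.integrable_of_hasCompactSupport
    hasCompactSupport_deriv_smoothTransition

lemma hasDerivAt_smoothTransition (x : ℝ) :
    HasDerivAt Real.smoothTransition (deriv Real.smoothTransition x) x :=
  ((Real.smoothTransition.contDiff (n := 1)).differentiable one_ne_zero x).hasDerivAt

lemma integral_deriv_smoothTransition : ∫ x, deriv Real.smoothTransition x = 1 := by
  rw [integral_of_hasDerivAt_of_tendsto (m := 0) (n := 1) hasDerivAt_smoothTransition
    integrable_deriv_smoothTransition, sub_zero]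
  · refine tendsto_const_nhds.congr' ?_
    filter_upwards [eventually_le_atBot 0] with x hx
    exact (Real.smoothTransition.zero_of_nonpos hx).symm
  · refine tendsto_const_nhds.congr' ?_
    filter_upwards [eventually_ge_atTop 1] with x hx
    exact (Real.smoothTransition.one_of_one_le hx).symm

lemma deriv_smoothTransition_nonneg (x : ℝ) : 0 ≤ deriv Real.smoothTransition x :=
  Real.smoothTransition.monotone.deriv_nonneg

lemma tendsto_smoothTransition_step (u x : ℝ) :
    Tendsto (fun n : ℕ => Real.smoothTransition ((x - u) / (1 / ((n : ℝ) + 1)))) atTop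
      (nhds (if u < x then 1 else 0)) := by
  split_ifs with h
  · refine tendsto_const_nhds.congr' ?_
    obtain ⟨N, hN⟩ := exists_nat_gt (1 / (x - u))
    filter_upwards [eventually_ge_atTop N] with n hn
    refine (Real.smoothTransition.one_of_one_le ?_).symm
    have hx : 0 < x - u := sub_pos.2 h
    rw [div_lt_iff₀ hx] at hN
    have : (N : ℝ) ≤ n := by exact_mod_cast hn
    rw [div_div_eq_mul_div, div_one]
    nlinarith
  · refine tendsto_const_nhds.congr fun n => ?_
    refine (Real.smoothTransition.zero_of_nonpos ?_).symm
    exact div_nonpos_of_nonpos_of_nonneg (by linarith) (by positivity)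

/-- Normal comparison inequality for products of two-step functions. -/
lemma abs_integral_prod_step_sub_le {Ω ι : Type*} [MeasurableSpace Ω] [Fintype ι]
    {P : Measure Ω} [IsProbabilityMeasure P] {X Y : ι → Ω → ℝ}
    (hXY : HasGaussianLaw (fun ω => (fun i => X i ω, fun i => Y i ω)) P)
    (hX0 : ∀ i, ∫ ω, X i ω ∂P = 0) (hY0 : ∀ i, ∫ ω, Y i ω ∂P = 0)
    (hcov : ∀ i j, cov[X i, Y j; P] = 0) (hX1 : ∀ i, cov[X i, X i; P] = 1)
    (hY1 : ∀ i, cov[Y i, Y i; P] = 1) {w : ι → ι → ℝ} {δ u v : ℝ}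
    (hXw : ∀ i j, i ≠ j → |cov[X i, X j; P]| ≤ w i j)
    (hYw : ∀ i j, i ≠ j → |cov[Y i, Y j; P]| ≤ w i j) (hwδ : ∀ i j, i ≠ j → w i j ≤ δ)
    (hδ : δ < 1) (hu : 0 ≤ u) (huv : u ≤ v) {α β : ι → ℝ} (hα : ∀ i, 0 ≤ α i)
    (hβ : ∀ i, 0 ≤ β i) (hαβ : ∀ i, α i + β i ≤ 1) :
    |∫ ω, ∏ i, (1 - (α i * if u < X i ω then 1 else 0) - β i * if v < X i ω then 1 else 0) ∂P -
      ∫ ω, ∏ i, (1 - (α i * if u < Y i ω then 1 else 0) - β i * if v < Y i ω then 1 else 0) ∂P| ≤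
      π / 2 * ∑ i, ∑ j ∈ Finset.univ.erase i, |cov[X i, X j; P] - cov[Y i, Y j; P]| *
        ((2 * π * √(1 - δ ^ 2))⁻¹ * exp (-(u ^ 2 / (1 + w i j)))) := by
  set h := Real.smoothTransition with hh
  set k := deriv Real.smoothTransition with hk
  set d : ℕ → ℝ := fun n => 1 / ((n : ℝ) + 1) with hd
  have hd0 : ∀ n, 0 < d n := fun n => by simp only [hd]; positivity
  have hkm : Measurable k := continuous_deriv_smoothTransition.measurable
  have hk0 : ∀ x, 0 ≤ k x := deriv_smoothTransition_nonneg
  obtain ⟨M, hM⟩ : ∃ M, ∀ x, k x ≤ M := by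
    obtain ⟨M, hM⟩ := continuous_deriv_smoothTransition.bounded_above_of_compact_support
      hasCompactSupport_deriv_smoothTransition
    exact ⟨M, fun x => (le_abs_self _).trans (hM x)⟩
  set G : ℕ → ι → ℝ → ℝ := fun n i x =>
    1 - α i * h ((x - u) / d n) - β i * h ((x - v) / d n) with hG
  set q : ℕ → ι → ℝ → ℝ := fun n i x =>
    α i * (k ((x - u) / d n) / d n) + β i * (k ((x - v) / d n) / d n) with hq
  have hk_int : ∀ n a, Integrable fun x => k ((x - a) / d n) / d n := fun n a =>
    (((integrable_deriv_smoothTransition.comp_div (hd0 n).ne').comp_sub_right a)).div_const _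
  have hk_one : ∀ n a, ∫ x, k ((x - a) / d n) / d n = 1 := fun n a => by
    rw [integral_div, integral_sub_right_eq_self (fun x => k (x / d n)) a,
      Measure.integral_comp_div, integral_deriv_smoothTransition, abs_of_pos (hd0 n), smul_eq_mul,
      mul_one, div_self (hd0 n).ne']
  have hderiv : ∀ n i x, HasDerivAt (G n i) (-q n i x) x := fun n i x => by
    have H : ∀ a, HasDerivAt (fun x => h ((x - a) / d n)) (k ((x - a) / d n) / d n) x := fun a => by
      have := (hasDerivAt_smoothTransition ((x - a) / d n)).comp x
        (((hasDerivAt_id x).sub_const a).div_const (d n))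
      refine this.congr_deriv ?_
      ring
    refine (((H u).const_mul (α i)).const_sub 1).sub ((H v).const_mul (β i)) |>.congr_deriv ?_
    simp only [hq]; ring
  have hq0 : ∀ n i x, 0 ≤ q n i x := fun n i x =>
    add_nonneg (mul_nonneg (hα i) (div_nonneg (hk0 _) (hd0 n).le))
      (mul_nonneg (hβ i) (div_nonneg (hk0 _) (hd0 n).le))
  have hqM : ∀ n i x, q n i x ≤ M / d n := fun n i x => by
    have h1 : ∀ a, k ((x - a) / d n) / d n ≤ M / d n := fun a => div_le_div_of_nonneg_right (hM _) (hd0 n).le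
    have h2 : 0 ≤ M / d n := (div_nonneg (hk0 _) (hd0 n).le).trans (h1 0)
    calc q n i x ≤ α i * (M / d n) + β i * (M / d n) :=
          add_le_add (mul_le_mul_of_nonneg_left (h1 _) (hα i))
            (mul_le_mul_of_nonneg_left (h1 _) (hβ i))
      _ = (α i + β i) * (M / d n) := by ring
      _ ≤ _ := mul_le_of_le_one_left h2 (hαβ i)
  have hqu : ∀ n i x, x < u → q n i x = 0 := fun n i x hx => by
    have : ∀ a, u ≤ a → k ((x - a) / d n) = 0 := fun a ha => by
      have hneg : (x - a) / d n < 0 := div_neg_of_neg_of_pos (by linarith) (hd0 n)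
      have : Real.smoothTransition =ᶠ[nhds ((x - a) / d n)] fun _ => 0 := by
        filter_upwards [Iio_mem_nhds hneg] with y hy
        exact Real.smoothTransition.zero_of_nonpos (le_of_lt hy)
      rw [hk, this.deriv_eq, deriv_const]
    simp only [hq, this u le_rfl, this v huv]; ring
  have hqi : ∀ n i, Integrable (q n i) := fun n i =>
    ((hk_int n u).const_mul _).add ((hk_int n v).const_mul _)
  have hq1 : ∀ n i, ∫ x, q n i x ≤ 1 := fun n i => by
    simp only [hq]
    rw [integral_add ((hk_int n u).const_mul _) ((hk_int n v).const_mul _), integral_const_mul,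
      integral_const_mul, hk_one, hk_one]
    linarith [hαβ i]
  have hqm : ∀ n i, Measurable (q n i) := fun n i => by
    simp only [hq]; fun_prop
  have h01 : ∀ x, 0 ≤ h x ∧ h x ≤ 1 := fun x =>
    ⟨Real.smoothTransition.nonneg x, Real.smoothTransition.le_one x⟩
  have hG1 : ∀ n i x, |G n i x| ≤ 1 := fun n i x => by
    rw [abs_le]
    have := h01 ((x - u) / d n)
    have := h01 ((x - v) / d n)
    simp only [hG]
    constructor <;> nlinarith [hα i, hβ i, hαβ i]
  have hXg : ∀ i, HasGaussianLaw (X i) P := fun i => hXY.fst.eval i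
  have hYg : ∀ i, HasGaussianLaw (Y i) P := fun i => hXY.snd.eval i
  have hsmooth : ∀ n, |∫ ω, ∏ i, G n i (X i ω) ∂P - ∫ ω, ∏ i, G n i (Y i ω) ∂P| ≤
      π / 2 * ∑ i, ∑ j ∈ Finset.univ.erase i, |cov[X i, X j; P] - cov[Y i, Y j; P]| *
        ((2 * π * √(1 - δ ^ 2))⁻¹ * exp (-(u ^ 2 / (1 + w i j)))) := by
    intro n
    refine abs_integral_prod_sub_integral_prod_le hXY hX0 hY0 hcov
      (fun i => (hX1 i).trans (hY1 i).symm) (hderiv n) (hG1 n) (C := M / d n) (fun i x => by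
        rw [abs_neg, abs_of_nonneg (hq0 n i x)]; exact hqM n i x) fun i j hij θ => ?_
    simp only [abs_neg, abs_of_nonneg (hq0 _ _ _)]
    have hZ : HasGaussianLaw (fun ω => (sin θ * X i ω + cos θ * Y i ω,
        sin θ * X j ω + cos θ * Y j ω)) P := by
      let L : ℝ × (ι → ℝ) →L[ℝ] ℝ × ℝ := (ContinuousLinearMap.fst ℝ ℝ (ι → ℝ)).prod
        ((ContinuousLinearMap.proj j).comp (ContinuousLinearMap.snd ℝ ℝ (ι → ℝ)))
      simpa [L] using (hasGaussianLaw_rotation hXY i (sin θ) (cos θ) (sin θ) (cos θ)).map_fun L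
    have hm : ∀ i, ∫ ω, (sin θ * X i ω + cos θ * Y i ω) ∂P = 0 := fun i => by
      rw [integral_add ((hXg i).integrable.const_mul _) ((hYg i).integrable.const_mul _),
        integral_const_mul, integral_const_mul, hX0, hY0]
      ring
    have hc : ∀ i j, cov[fun ω => sin θ * X i ω + cos θ * Y i ω,
        fun ω => sin θ * X j ω + cos θ * Y j ω; P] =
        sin θ * sin θ * cov[X i, X j; P] + cos θ * cos θ * cov[Y i, Y j; P] := fun i j =>
      covariance_rotation (hXg i).memLp_two (hXg j).memLp_two (hYg i).memLp_two
        (hYg j).memLp_two (hcov i j) (by rw [covariance_comm]; exact hcov j i) _ _ _ _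
    have hsc := sin_sq_add_cos_sq θ
    have hv1 : ∀ i, cov[fun ω => sin θ * X i ω + cos θ * Y i ω,
        fun ω => sin θ * X i ω + cos θ * Y i ω; P] = 1 := fun i => by
      rw [hc, hX1, hY1]; linarith
    have hw : |cov[fun ω => sin θ * X i ω + cos θ * Y i ω,
        fun ω => sin θ * X j ω + cos θ * Y j ω; P]| ≤ w i j := by
      rw [hc]
      have h1 := hXw i j hij
      have h2 := hYw i j hij
      rw [abs_le] at h1 h2 ⊢
      have hs2 := mul_self_nonneg (sin θ)
      have hc2 := mul_self_nonneg (cos θ)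
      have : w i j = sin θ * sin θ * w i j + cos θ * cos θ * w i j := by
        rw [← add_mul, show sin θ * sin θ + cos θ * cos θ = 1 by linarith, one_mul]
      constructor
      · rw [this]; nlinarith [mul_le_mul_of_nonneg_left h1.1 hs2, mul_le_mul_of_nonneg_left h2.1 hc2]
      · rw [this]; nlinarith [mul_le_mul_of_nonneg_left h1.2 hs2, mul_le_mul_of_nonneg_left h2.2 hc2]
    refine (integral_mul_le_of_hasGaussianLaw hZ (hm i) (hm j) (hv1 i) (hv1 j) hw (hwδ i j hij) hδ
      hu (hq0 n i) (hq0 n j) (hqM n i) (hqM n j) (hqu n i) (hqu n j) (hqi n i) (hqi n j) (hqm n i)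
      (hqm n j)).trans ?_
    refine mul_le_of_le_one_right (by positivity) ?_
    exact mul_le_one₀ (hq1 n i) (integral_nonneg (hq0 n j)) (hq1 n j)
  have hlim : ∀ Z : ι → Ω → ℝ, (∀ i, AEMeasurable (Z i) P) →
      Tendsto (fun n => ∫ ω, ∏ i, G n i (Z i ω) ∂P) atTop (nhds (∫ ω, ∏ i,
        (1 - (α i * if u < Z i ω then 1 else 0) - β i * if v < Z i ω then 1 else 0) ∂P)) := by
    intro Z hZ
    refine tendsto_integral_of_dominated_convergence (fun _ => 1) (fun n => ?_)
      (integrable_const _) (fun n => ae_of_all _ fun ω => ?_) (ae_of_all _ fun ω => ?_)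
    · refine (Finset.aemeasurable_fun_prod _ fun i _ => ?_).aestronglyMeasurable
      exact (continuous_iff_continuousAt.2 fun x =>
        (hderiv n i x).continuousAt).measurable.comp_aemeasurable (hZ i)
    · rw [norm_eq_abs, Finset.abs_prod]
      exact Finset.prod_le_one (fun _ _ => abs_nonneg _) fun j _ => hG1 n j _
    · refine tendsto_finsetProd _ fun i _ => ?_
      exact ((tendsto_const_nhds.sub ((tendsto_smoothTransition_step u _).const_mul _)).sub
        ((tendsto_smoothTransition_step v _).const_mul _))
  exact le_of_tendsto ((hlim X fun i => (hXg i).aemeasurable).sub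
    (hlim Y fun i => (hYg i).aemeasurable)).abs (Eventually.of_forall hsmooth)

/-- Normal comparison inequality for Gaussian vectors on possibly different spaces. -/
lemma abs_integral_prod_step_sub_le' {Ω Ω' ι : Type*} [MeasurableSpace Ω] [MeasurableSpace Ω']
    [Fintype ι] {P : Measure Ω} [IsProbabilityMeasure P] {Q : Measure Ω'} [IsProbabilityMeasure Q]
    {X : ι → Ω → ℝ} {Y : ι → Ω' → ℝ}
    (hX : HasGaussianLaw (fun ω i => X i ω) P) (hY : HasGaussianLaw (fun ω i => Y i ω) Q)
    (hXm : ∀ i, Measurable (X i)) (hYm : ∀ i, Measurable (Y i))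
    (hX0 : ∀ i, ∫ ω, X i ω ∂P = 0) (hY0 : ∀ i, ∫ ω, Y i ω ∂Q = 0)
    (hX1 : ∀ i, cov[X i, X i; P] = 1)
    (hY1 : ∀ i, cov[Y i, Y i; Q] = 1) {w : ι → ι → ℝ} {δ u v : ℝ}
    (hXw : ∀ i j, i ≠ j → |cov[X i, X j; P]| ≤ w i j)
    (hYw : ∀ i j, i ≠ j → |cov[Y i, Y j; Q]| ≤ w i j) (hwδ : ∀ i j, i ≠ j → w i j ≤ δ)
    (hδ : δ < 1) (hu : 0 ≤ u) (huv : u ≤ v) {α β : ι → ℝ} (hα : ∀ i, 0 ≤ α i)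
    (hβ : ∀ i, 0 ≤ β i) (hαβ : ∀ i, α i + β i ≤ 1) :
    |∫ ω, ∏ i, (1 - (α i * if u < X i ω then 1 else 0) - β i * if v < X i ω then 1 else 0) ∂P -
      ∫ ω, ∏ i, (1 - (α i * if u < Y i ω then 1 else 0) - β i * if v < Y i ω then 1 else 0) ∂Q| ≤
      π / 2 * ∑ i, ∑ j ∈ Finset.univ.erase i, |cov[X i, X j; P] - cov[Y i, Y j; Q]| *
        ((2 * π * √(1 - δ ^ 2))⁻¹ * exp (-(u ^ 2 / (1 + w i j)))) := by
  have hpX : MeasurePreserving (Prod.fst : Ω × Ω' → Ω) (P.prod Q) P := measurePreserving_fst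
  have hpY : MeasurePreserving (Prod.snd : Ω × Ω' → Ω') (P.prod Q) Q := measurePreserving_snd
  have iX : ∀ f : Ω → ℝ, Measurable f → ∫ p, f p.1 ∂(P.prod Q) = ∫ ω, f ω ∂P := fun f hf => by
    rw [← hpX.map_eq, integral_map (by fun_prop)]
    · rw [hpX.map_eq]
    · exact hf.aestronglyMeasurable
  have iY : ∀ f : Ω' → ℝ, Measurable f → ∫ p, f p.2 ∂(P.prod Q) = ∫ ω, f ω ∂Q := fun f hf => by
    rw [← hpY.map_eq, integral_map (by fun_prop)]
    · rw [hpY.map_eq]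
    · exact hf.aestronglyMeasurable
  have cX : ∀ i j, cov[fun p : Ω × Ω' => X i p.1, fun p => X j p.1; P.prod Q] = cov[X i, X j; P] :=
    fun i j => by
      simp only [covariance]
      rw [iX _ (hXm i), iX _ (hXm j), iX (fun ω => (X i ω - ∫ ω, X i ω ∂P) *
        (X j ω - ∫ ω, X j ω ∂P)) (by fun_prop)]
  have cY : ∀ i j, cov[fun p : Ω × Ω' => Y i p.2, fun p => Y j p.2; P.prod Q] = cov[Y i, Y j; Q] :=
    fun i j => by
      simp only [covariance]
      rw [iY _ (hYm i), iY _ (hYm j), iY (fun ω => (Y i ω - ∫ ω, Y i ω ∂Q) *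
        (Y j ω - ∫ ω, Y j ω ∂Q)) (by fun_prop)]
  have hXY : HasGaussianLaw (fun p : Ω × Ω' =>
      ((fun i => X i p.1 : ι → ℝ), (fun i => Y i p.2 : ι → ℝ))) (P.prod Q) := by
    refine IndepFun.hasGaussianLaw ?_ ?_ ?_
    · refine ⟨?_⟩
      have := hX.isGaussian_map
      rw [← hpX.map_eq, Measure.map_map (by fun_prop) (by fun_prop)] at this
      exact this
    · refine ⟨?_⟩
      have := hY.isGaussian_map
      rw [← hpY.map_eq, Measure.map_map (by fun_prop) (by fun_prop)] at this
      exact this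
    · exact indepFun_prod (X := fun ω i => X i ω) (Y := fun ω i => Y i ω) (by fun_prop)
        (by fun_prop)
  have hind : ∀ i j, IndepFun (fun p : Ω × Ω' => X i p.1) (fun p => Y j p.2) (P.prod Q) :=
    fun i j => indepFun_prod (hXm i) (hYm j)
  have key := abs_integral_prod_step_sub_le (X := fun i (p : Ω × Ω') => X i p.1)
    (Y := fun i p => Y i p.2)
    hXY (fun i => by rw [iX _ (hXm i), hX0]) (fun i => by rw [iY _ (hYm i), hY0])
    (fun i j => (hind i j).covariance_eq_zero (hXY.fst.eval i).memLp_two (hXY.snd.eval j).memLp_two)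
    (fun i => by rw [cX, hX1]) (fun i => by rw [cY, hY1]) (w := w)
    (fun i j hij => by rw [cX]; exact hXw i j hij) (fun i j hij => by rw [cY]; exact hYw i j hij)
    hwδ hδ hu huv hα hβ hαβ
  have hstep : ∀ i, Measurable fun x : ℝ =>
      (1 - (α i * if u < x then 1 else 0) - β i * if v < x then 1 else 0) := fun i =>
    (measurable_const.sub ((Measurable.ite measurableSet_Ioi measurable_const
      measurable_const).const_mul _)).sub
      ((Measurable.ite measurableSet_Ioi measurable_const measurable_const).const_mul _)
  rw [iX (fun ω => ∏ i, (1 - (α i * if u < X i ω then 1 else 0) - β i * if v < X i ω then 1 else 0))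
    (Finset.measurable_fun_prod _ fun i _ => (hstep i).comp (hXm i)),
    iY (fun ω => ∏ i, (1 - (α i * if u < Y i ω then 1 else 0) - β i * if v < Y i ω then 1 else 0))
    (Finset.measurable_fun_prod _ fun i _ => (hstep i).comp (hYm i))] at key
  simpa only [cX, cY] using key

lemma tendsto_log_natCast_atTop : Tendsto (fun n : ℕ => log (n : ℝ)) atTop atTop :=
  tendsto_log_atTop.comp tendsto_natCast_atTop_atTop

lemma un_eq (n : ℕ) (x : ℝ) :
    un n x = √(2 * log n) + (x - (log (log n) + log (4 * π)) / 2) / √(2 * log n) := by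
  rw [un]; ring

lemma un_sq_eq {n : ℕ} (hn : 0 < log (n : ℝ)) (x : ℝ) :
    un n x ^ 2 = 2 * log n + 2 * x - (log (log n) + log (4 * π)) +
      ((x - (log (log n) + log (4 * π)) / 2) / √(2 * log n)) ^ 2 := by
  have ha : 0 < √(2 * log (n : ℝ)) := sqrt_pos.2 (by linarith)
  have h2 : √(2 * log (n : ℝ)) ^ 2 = 2 * log n := sq_sqrt (by linarith)
  rw [un_eq, add_sq, h2]
  field_simp
  ring

lemma un_mono {n : ℕ} {x y : ℝ} (h : x ≤ y) : un n x ≤ un n y := by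
  unfold un; gcongr

/-- `log log n + log 4π` is negligible with respect to `√(log n)`. -/
lemma tendsto_un_correction (x : ℝ) :
    Tendsto (fun n : ℕ => (x - (log (log n) + log (4 * π)) / 2) / √(2 * log n)) atTop (nhds 0) := by
  have h : Tendsto (fun t : ℝ => (x - (log t + log (4 * π)) / 2) / √(2 * t)) atTop (nhds 0) := by
    have h1 : Tendsto (fun t : ℝ => log t / t ^ (1 / 2 : ℝ)) atTop (nhds 0) :=
      (isLittleO_log_rpow_atTop (by norm_num)).tendsto_div_nhds_zero
    have h2 : Tendsto (fun t : ℝ => (t ^ (1 / 2 : ℝ))⁻¹) atTop (nhds 0) :=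
      (tendsto_rpow_atTop (by norm_num)).inv_tendsto_atTop
    have h3 : Tendsto (fun t : ℝ => (√2)⁻¹ * ((x - log (4 * π) / 2) * (t ^ (1 / 2 : ℝ))⁻¹ -
        (1 / 2) * (log t / t ^ (1 / 2 : ℝ)))) atTop
        (nhds ((√2)⁻¹ * ((x - log (4 * π) / 2) * 0 - (1 / 2) * 0))) :=
      ((h2.const_mul _).sub (h1.const_mul _)).const_mul _
    rw [mul_zero, mul_zero, sub_zero, mul_zero] at h3
    refine h3.congr fun t => ?_
    rw [sqrt_mul (by norm_num), sqrt_eq_rpow t]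
    ring
  exact h.comp tendsto_log_natCast_atTop

lemma tendsto_sqrt_two_mul_log_atTop : Tendsto (fun n : ℕ => √(2 * log (n : ℝ))) atTop atTop :=
  tendsto_sqrt_atTop.comp (tendsto_log_natCast_atTop.const_mul_atTop two_pos)

lemma tendsto_un_atTop (x : ℝ) : Tendsto (fun n => un n x) atTop atTop := by
  simp_rw [un_eq]
  exact tendsto_sqrt_two_mul_log_atTop.atTop_add (tendsto_un_correction x)

lemma eventually_un_sq_le (x : ℝ) : ∀ᶠ n : ℕ in atTop, un n x ^ 2 ≤ 8 * log n := by
  filter_upwards [(tendsto_un_correction x).eventually_le_const one_pos,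
    tendsto_sqrt_two_mul_log_atTop.eventually_ge_atTop 1,
    (tendsto_un_atTop x).eventually_ge_atTop 0, tendsto_log_natCast_atTop.eventually_gt_atTop 0]
    with n h1 h2 h3 h4
  have h5 : un n x ≤ 2 * √(2 * log n) := by rw [un_eq]; linarith
  calc un n x ^ 2 ≤ (2 * √(2 * log n)) ^ 2 := by gcongr
    _ = 8 * log n := by rw [mul_pow, sq_sqrt (by linarith)]; ring

lemma exp_neg_un_sq_le {n : ℕ} (hn : 0 < log (n : ℝ)) (x : ℝ) :
    exp (-un n x ^ 2) ≤ (4 * π * exp (-(2 * x))) * log n / (n : ℝ) ^ 2 := by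
  have hn0 : 0 < (n : ℝ) := by
    rcases Nat.eq_zero_or_pos n with h | h
    · simp [h] at hn
    · exact_mod_cast h
  have e : (4 * π * exp (-(2 * x))) * log n / (n : ℝ) ^ 2 =
      exp (-(2 * log n + 2 * x - (log (log n) + log (4 * π)))) := by
    rw [show -(2 * log (n : ℝ) + 2 * x - (log (log n) + log (4 * π))) =
      (log (4 * π) + -(2 * x) + log (log n)) - (log n + log n) by ring, exp_sub, exp_add, exp_add,
      exp_add, exp_log (by positivity), exp_log hn, exp_log hn0, sq]
  rw [e, un_sq_eq hn]
  gcongr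
  have := sq_nonneg ((x - (log (log n) + log (4 * π)) / 2) / √(2 * log n))
  linarith

lemma sum_Icc_log (n : ℕ) : ∑ k ∈ Finset.Icc 1 n, log (k : ℝ) = log (n.factorial : ℝ) := by
  induction n with
  | zero => simp
  | succ n ih =>
    rw [Finset.sum_Icc_succ_top (by omega), ih, Nat.factorial_succ, Nat.cast_mul,
      log_mul (by positivity) (by positivity)]
    ring

lemma sum_log_sub_log_le (n : ℕ) : ∑ k ∈ Finset.Icc 1 n, (log n - log k) ≤ n := by
  rcases Nat.eq_zero_or_pos n with rfl | hn
  · simp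
  have h2 := Real.pow_div_factorial_le_exp (n : ℝ) (Nat.cast_nonneg n) n
  have hn' : (0 : ℝ) < n := by exact_mod_cast hn
  have h3 := log_le_log (by positivity) h2
  rw [log_exp, log_div (by positivity) (by positivity), log_pow] at h3
  rw [Finset.sum_sub_distrib, sum_Icc_log]
  simpa using h3

lemma tendsto_sum_Icc_div {s : ℕ → ℝ} {l : ℝ} (h : Tendsto s atTop (nhds l)) :
    Tendsto (fun n : ℕ => (∑ k ∈ Finset.Icc 1 n, s k) / n) atTop (nhds l) := by
  have := ((tendsto_add_atTop_iff_nat 1).2 h).cesaro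
  refine this.congr fun n => ?_
  rw [div_eq_inv_mul, Finset.range_eq_Ico, Finset.sum_Ico_add' s 0 n 1]
  rfl

/-- The sum in the normal comparison inequality vanishes asymptotically when the covariances
decay like `γ / log n`. -/
lemma tendsto_covariance_sum {r : ℕ → ℝ} {γ δ x : ℝ} (hγ : 0 ≤ γ)
    (hr : Tendsto (fun n : ℕ => r n * log n) atTop (nhds γ)) (hδ0 : 0 < δ) (hδ1 : δ < 1)
    (hrδ : ∀ k, 1 ≤ k → |r k| ≤ δ) :
    Tendsto (fun n : ℕ => (n : ℝ) * ∑ k ∈ Finset.Icc 1 n, |r k - γ / log n| *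
      exp (-(un n x ^ 2 / (1 + max |r k| (γ / log n))))) atTop (nhds 0) := by
  set α : ℝ := (1 - δ) / (2 * (1 + δ)) with hα
  have hα0 : 0 < α := by rw [hα]; apply div_pos <;> linarith
  have hα1 : α < 1 := by rw [hα, div_lt_one (by linarith)]; linarith
  obtain ⟨K, hK⟩ : ∃ K : ℝ, ∀ k : ℕ, |r k * log k| ≤ K := by
    obtain ⟨K, hK⟩ := hr.abs.bddAbove_range
    exact ⟨K, fun k => hK ⟨k, rfl⟩⟩
  have hK0 : 0 ≤ K := (abs_nonneg _).trans (hK 0)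
  set K' := K / α + γ with hK'
  have hK'0 : 0 ≤ K' := by positivity
  set C := 4 * π * exp (-(2 * x)) with hC
  have hC0 : 0 < C := by positivity
  set D := exp (8 * K') * C with hD
  have hD0 : 0 < D := by positivity
  set s : ℕ → ℝ := fun k => |r k * log k - γ| with hs
  have hsl : Tendsto (fun n : ℕ => (∑ k ∈ Finset.Icc 1 n, s k) / n) atTop (nhds 0) := by
    refine tendsto_sum_Icc_div ?_
    simpa using (hr.sub_const γ).abs
  have hLtop := tendsto_log_natCast_atTop
  have hlim : Tendsto (fun n : ℕ => 2 * (C + 1) * (log n / (n : ℝ) ^ α) +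
      (D / α * ((∑ k ∈ Finset.Icc 1 n, s k) / n) + D * γ / α * (log n)⁻¹)) atTop (nhds 0) := by
    have h1 : Tendsto (fun n : ℕ => log n / (n : ℝ) ^ α) atTop (nhds 0) :=
      (isLittleO_log_rpow_atTop hα0).tendsto_div_nhds_zero.comp tendsto_natCast_atTop_atTop
    simpa using (h1.const_mul (2 * (C + 1))).add
      ((hsl.const_mul (D / α)).add (hLtop.inv_tendsto_atTop.const_mul (D * γ / α)))
  refine squeeze_zero' (Eventually.of_forall fun n => ?_) ?_ hlim
  · exact mul_nonneg (Nat.cast_nonneg _) (Finset.sum_nonneg fun k _ => by positivity)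
  have hρ : Tendsto (fun n : ℕ => γ / log (n : ℝ)) atTop (nhds 0) :=
    hLtop.const_div_atTop γ
  filter_upwards [hLtop.eventually_ge_atTop 1, hρ.eventually_le_const hδ0, eventually_un_sq_le x]
    with n hL hρδ hu
  set L := log (n : ℝ) with hLdef
  have hL0 : 0 < L := by linarith
  have hn0 : 0 < (n : ℝ) := by
    rcases Nat.eq_zero_or_pos n with h | h
    · simp [hLdef, h] at hL; linarith
    · exact_mod_cast h
  have hexp := exp_neg_un_sq_le hL0 x
  rw [← hC] at hexp
  have hu0 := sq_nonneg (un n x)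
  have hρ0 : 0 ≤ γ / L := by positivity
  set E := 2 * exp (-(un n x ^ 2 / (1 + δ))) with hE
  have hterm : ∀ k ∈ Finset.Icc 1 n, |r k - γ / L| * exp (-(un n x ^ 2 / (1 + max |r k| (γ / L)))) ≤
      (if (k : ℝ) ≤ (n : ℝ) ^ α then E else 0) +
        D * L / (n : ℝ) ^ 2 * (s k / (α * L) + γ * (L - log k) / (α * L * L)) := by
    intro k hk
    obtain ⟨hk1, hkn⟩ := Finset.mem_Icc.1 hk
    have hk1' : (1 : ℝ) ≤ k := by exact_mod_cast hk1
    have hkn' : (k : ℝ) ≤ n := by exact_mod_cast hkn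
    have hlk : log (k : ℝ) ≤ L := log_le_log (by linarith) hkn'
    have hpos : 0 ≤ D * L / (n : ℝ) ^ 2 * (s k / (α * L) + γ * (L - log k) / (α * L * L)) := by
      have : 0 ≤ L - log k := by linarith
      have : 0 ≤ s k := abs_nonneg _
      positivity
    split_ifs with hka
    · have h1 : |r k - γ / L| ≤ 2 := by
        have := abs_sub (r k) (γ / L)
        rw [abs_of_nonneg hρ0] at this
        linarith [hrδ k hk1]
      have h2 : un n x ^ 2 / (1 + δ) ≤ un n x ^ 2 / (1 + max |r k| (γ / L)) := by
        have : max |r k| (γ / L) ≤ δ := max_le (hrδ k hk1) hρδ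
        have : 0 ≤ max |r k| (γ / L) := hρ0.trans (le_max_right _ _)
        gcongr
      have h3 : |r k - γ / L| * exp (-(un n x ^ 2 / (1 + max |r k| (γ / L)))) ≤ E := by
        rw [hE]; gcongr
      linarith
    · rw [zero_add]
      have hlk' : α * L ≤ log k := by
        rw [hLdef, ← log_rpow hn0]
        exact log_le_log (by positivity) (not_le.1 hka).le
      have hαL : 0 < α * L := by positivity
      have hlk0 : 0 < log (k : ℝ) := by linarith
      have hrk : |r k| ≤ K / (α * L) := by
        have := hK k
        rw [abs_mul, abs_of_pos hlk0] at this
        rw [le_div_iff₀ hαL]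
        exact (mul_le_mul_of_nonneg_left hlk' (abs_nonneg _)).trans this
      have hmax0 : 0 ≤ max |r k| (γ / L) := hρ0.trans (le_max_right _ _)
      have hmax : max |r k| (γ / L) ≤ K' / L := by
        have e : K' / L = K / (α * L) + γ / L := by rw [hK']; field_simp
        rw [e]
        exact max_le (by linarith) (le_add_of_nonneg_left (by positivity))
      have hex : exp (-(un n x ^ 2 / (1 + max |r k| (γ / L)))) ≤ D * L / (n : ℝ) ^ 2 := by
        have h1 : un n x ^ 2 - 8 * K' ≤ un n x ^ 2 / (1 + max |r k| (γ / L)) := by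
          rw [le_div_iff₀ (by linarith)]
          have : un n x ^ 2 * max |r k| (γ / L) ≤ 8 * K' := by
            calc un n x ^ 2 * max |r k| (γ / L) ≤ (8 * L) * (K' / L) := by gcongr
              _ = 8 * K' := by field_simp
          nlinarith [mul_nonneg hK'0 hmax0]
        calc exp (-(un n x ^ 2 / (1 + max |r k| (γ / L)))) ≤ exp (8 * K' + -un n x ^ 2) := by
              gcongr; linarith
          _ = exp (8 * K') * exp (-un n x ^ 2) := exp_add _ _
          _ ≤ exp (8 * K') * (C * L / (n : ℝ) ^ 2) := by gcongr
          _ = _ := by rw [hD]; ring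
      have hdiff : |r k - γ / L| ≤ s k / (α * L) + γ * (L - log k) / (α * L * L) := by
        have e : r k - γ / L = (r k * log k - γ) / log k + γ * (L - log k) / (log k * L) := by
          field_simp; ring
        have hnn : 0 ≤ γ * (L - log k) := mul_nonneg hγ (by linarith)
        rw [e]
        refine (abs_add_le _ _).trans (add_le_add ?_ ?_)
        · rw [abs_div, abs_of_pos hlk0]
          gcongr
        · rw [abs_of_nonneg (by positivity)]
          gcongr
      rw [mul_comm]
      exact mul_le_mul hex hdiff (abs_nonneg _) (by positivity)
  have hcount : ∑ k ∈ Finset.Icc 1 n, (if (k : ℝ) ≤ (n : ℝ) ^ α then E else 0) ≤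
      (n : ℝ) ^ α * E := by
    rw [← Finset.sum_filter, Finset.sum_const, nsmul_eq_mul]
    have hE0 : 0 ≤ E := by positivity
    refine mul_le_mul_of_nonneg_right ?_ hE0
    have hsub : (Finset.Icc 1 n).filter (fun k : ℕ => (k : ℝ) ≤ (n : ℝ) ^ α) ⊆
        Finset.Icc 1 ⌊(n : ℝ) ^ α⌋₊ := fun k hk => by
      rw [Finset.mem_filter, Finset.mem_Icc] at hk
      exact Finset.mem_Icc.2 ⟨hk.1.1, Nat.le_floor hk.2⟩
    calc _ ≤ (((Finset.Icc 1 ⌊(n : ℝ) ^ α⌋₊).card : ℕ) : ℝ) := by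
          exact_mod_cast Finset.card_le_card hsub
      _ = (⌊(n : ℝ) ^ α⌋₊ : ℝ) := by rw [Nat.card_Icc, Nat.add_sub_cancel]
      _ ≤ _ := Nat.floor_le (by positivity)
  have hEle : exp (-(un n x ^ 2 / (1 + δ))) ≤ (C + 1) * L * ((n : ℝ) ^ (-(1 + 2 * α))) := by
    set β := (1 + δ)⁻¹ with hβ
    have hβ0 : 0 < β := by rw [hβ]; apply inv_pos.2; linarith
    have hβ1 : β ≤ 1 := inv_le_one_of_one_le₀ (by linarith)
    have e1 : exp (-(un n x ^ 2 / (1 + δ))) = exp (-un n x ^ 2) ^ β := by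
      rw [← exp_mul]; congr 1; rw [hβ]; ring
    have e2 : ((n : ℝ) ^ 2) ^ β = (n : ℝ) ^ (1 + 2 * α) := by
      rw [← rpow_natCast, ← rpow_mul hn0.le]
      congr 1
      rw [hβ, hα]
      have : 1 + δ ≠ 0 := by linarith
      field_simp
      push_cast
      ring
    rw [e1]
    calc exp (-un n x ^ 2) ^ β ≤ (C * L / (n : ℝ) ^ 2) ^ β := by gcongr
      _ ≤ ((C + 1) * L / (n : ℝ) ^ 2) ^ β := by gcongr; linarith
      _ = ((C + 1) * L) ^ β / (n : ℝ) ^ (1 + 2 * α) := by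
          rw [div_rpow (by positivity) (by positivity), e2]
      _ ≤ ((C + 1) * L) ^ (1 : ℝ) / (n : ℝ) ^ (1 + 2 * α) := by
          gcongr
          nlinarith
      _ = _ := by rw [rpow_one, rpow_neg hn0.le]; rfl
  calc (n : ℝ) * ∑ k ∈ Finset.Icc 1 n, |r k - γ / L| *
        exp (-(un n x ^ 2 / (1 + max |r k| (γ / L))))
      ≤ n * ∑ k ∈ Finset.Icc 1 n, ((if (k : ℝ) ≤ (n : ℝ) ^ α then E else 0) +
        D * L / (n : ℝ) ^ 2 * (s k / (α * L) + γ * (L - log k) / (α * L * L))) := by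
        gcongr with k hk
        exact hterm k hk
    _ = n * (∑ k ∈ Finset.Icc 1 n, (if (k : ℝ) ≤ (n : ℝ) ^ α then E else 0)) +
        (D / α * ((∑ k ∈ Finset.Icc 1 n, s k) / n) +
          D * γ / α * L⁻¹ * ((∑ k ∈ Finset.Icc 1 n, (L - log k)) / n)) := by
        rw [Finset.sum_add_distrib, ← Finset.mul_sum, Finset.sum_add_distrib, ← Finset.sum_div,
          ← Finset.sum_div, ← Finset.mul_sum]
        field_simp
    _ ≤ n * ((n : ℝ) ^ α * (2 * ((C + 1) * L * ((n : ℝ) ^ (-(1 + 2 * α)))))) +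
        (D / α * ((∑ k ∈ Finset.Icc 1 n, s k) / n) + D * γ / α * L⁻¹ * 1) := by
        gcongr
        · refine hcount.trans ?_
          rw [hE]
          gcongr
        · rw [div_le_one hn0]
          exact sum_log_sub_log_le n
    _ = _ := by
        rw [mul_one]
        congr 1
        have : (n : ℝ) * ((n : ℝ) ^ α * (n : ℝ) ^ (-(1 + 2 * α))) = ((n : ℝ) ^ α)⁻¹ := by
          rw [← rpow_add hn0, ← rpow_neg hn0.le]
          nth_rewrite 1 [← rpow_one (n : ℝ)]
          rw [← rpow_add hn0]
          congr 1; ring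
        rw [div_eq_mul_inv, ← this]
        ring

lemma hasGaussianLaw_of_linearCombination {Ω : Type*} [MeasurableSpace Ω] {P : Measure Ω}
    {X : ℕ → Ω → ℝ} (hXmeas : ∀ n, Measurable (X n))
    (hGauss : ∀ (m : ℕ) (idx : Fin m → ℕ) (c : Fin m → ℝ), ∃ v : ℝ≥0,
      Measure.map (fun ω => ∑ i, c i * X (idx i) ω) P = gaussianReal 0 v)
    (m : ℕ) (idx : Fin m → ℕ) : HasGaussianLaw (fun ω i => X (idx i) ω) P := by
  refine ⟨isGaussian_of_isGaussian_map fun L => ?_⟩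
  obtain ⟨v, hv⟩ := hGauss m idx fun i => L fun j => if i = j then 1 else 0
  have hm : Measurable fun ω i => X (idx i) ω := measurable_pi_lambda _ fun i => hXmeas _
  rw [Measure.map_map L.continuous.measurable hm]
  have : (⇑L ∘ fun ω i => X (idx i) ω) =
      fun ω => ∑ i, L (fun j => if i = j then 1 else 0) * X (idx i) ω := by
    ext ω
    have := L.toLinearMap.pi_apply_eq_sum_univ fun i => X (idx i) ω
    rw [Function.comp_apply, ← ContinuousLinearMap.coe_coe, this]
    exact Finset.sum_congr rfl fun i _ => by rw [smul_eq_mul, mul_comm]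
  rw [this, hv]
  infer_instance

lemma integral_eq_zero_of_map_eq_gaussianReal {Ω : Type*} [MeasurableSpace Ω] {P : Measure Ω}
    {Z : Ω → ℝ} (hZ : Measurable Z) (h : P.map Z = gaussianReal 0 1) : ∫ ω, Z ω ∂P = 0 := by
  have := integral_map (μ := P) hZ.aemeasurable (f := fun x : ℝ => x) (by fun_prop)
  rw [← this, h, integral_id_gaussianReal]

lemma integral_mul_self_gaussianReal : ∫ x, x * x ∂gaussianReal 0 1 = 1 := by
  have := variance_of_integral_eq_zero (μ := gaussianReal 0 1) (X := fun x : ℝ => x)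
    (by fun_prop) integral_id_gaussianReal
  rw [variance_fun_id_gaussianReal] at this
  simpa [sq] using this.symm

lemma integral_mul_self_eq_one {Ω : Type*} [MeasurableSpace Ω] {P : Measure Ω} {Z : Ω → ℝ}
    (hZ : Measurable Z) (h : P.map Z = gaussianReal 0 1) : ∫ ω, Z ω * Z ω ∂P = 1 := by
  have := integral_map (μ := P) hZ.aemeasurable (f := fun x : ℝ => x * x) (by fun_prop)
  rw [← this, h, integral_mul_self_gaussianReal]

lemma memLp_two_of_map_eq_gaussianReal {Ω : Type*} [MeasurableSpace Ω] {P : Measure Ω} {Z : Ω → ℝ}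
    (h : P.map Z = gaussianReal 0 1) : MemLp Z 2 P :=
  HasGaussianLaw.memLp_two ⟨by rw [h]; infer_instance⟩

lemma integral_mul_shift {Ω : Type*} [MeasurableSpace Ω] {P : Measure Ω}
    {X : ℕ → Ω → ℝ} (hXmeas : ∀ n, Measurable (X n)) (hstat : ∀ (m k : ℕ),
      Measure.map (fun ω => fun i : Fin m => X (i.1 + 1 + k) ω) P =
        Measure.map (fun ω => fun i : Fin m => X (i.1 + 1) ω) P) (i k : ℕ) :
    ∫ ω, X (i + 1) ω * X (i + k + 1) ω ∂P = ∫ ω, X 1 ω * X (k + 1) ω ∂P := by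
  have h := hstat (k + 1) i
  have hm : Measurable fun p : Fin (k + 1) → ℝ => p 0 * p (Fin.last k) :=
    (measurable_pi_apply _).mul (measurable_pi_apply _)
  have h1 := integral_map (μ := P) (φ := fun ω => fun j : Fin (k + 1) => X (j.1 + 1 + i) ω)
    (measurable_pi_lambda _ fun j => hXmeas _).aemeasurable hm.aestronglyMeasurable
  have h2 := integral_map (μ := P) (φ := fun ω => fun j : Fin (k + 1) => X (j.1 + 1) ω)
    (measurable_pi_lambda _ fun j => hXmeas _).aemeasurable hm.aestronglyMeasurable
  rw [h, h2] at h1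
  simp only [Fin.val_zero, Fin.val_last, zero_add] at h1
  rw [h1, add_comm 1 i, show k + 1 + i = i + k + 1 by ring]

/-- The covariances of a stationary standard Gaussian sequence that tend to zero are bounded
away from one. -/
lemma exists_abs_covariance_le {Ω : Type*} [MeasurableSpace Ω] {P : Measure Ω}
    {X : ℕ → Ω → ℝ} (hXmeas : ∀ n, Measurable (X n))
    (hstd : ∀ n, Measure.map (X n) P = gaussianReal 0 1) (hstat : ∀ (m k : ℕ),
      Measure.map (fun ω => fun i : Fin m => X (i.1 + 1 + k) ω) P =
        Measure.map (fun ω => fun i : Fin m => X (i.1 + 1) ω) P)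
    (hr : Tendsto (fun n : ℕ => ∫ ω, X 1 ω * X (n + 1) ω ∂P) atTop (nhds 0)) :
    ∃ δ : ℝ, 0 < δ ∧ δ < 1 ∧ ∀ k, 1 ≤ k → |∫ ω, X 1 ω * X (k + 1) ω ∂P| ≤ δ := by
  set r : ℕ → ℝ := fun n => ∫ ω, X 1 ω * X (n + 1) ω ∂P with hrdef
  have hL2 : ∀ n, MemLp (X n) 2 P := fun n => memLp_two_of_map_eq_gaussianReal (hstd n)
  have hint : ∀ i j, Integrable (fun ω => X i ω * X j ω) P := fun i j =>
    (hL2 i).integrable_mul (hL2 j)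
  have hD : ∀ i k, ∫ ω, (X (i + k + 1) ω - r k * X (i + 1) ω) ^ 2 ∂P = 1 - r k ^ 2 := by
    intro i k
    have e : ∀ ω, (X (i + k + 1) ω - r k * X (i + 1) ω) ^ 2 =
        X (i + k + 1) ω * X (i + k + 1) ω - 2 * r k * (X (i + 1) ω * X (i + k + 1) ω) +
          r k ^ 2 * (X (i + 1) ω * X (i + 1) ω) := fun ω => by ring
    simp_rw [e]
    have hA : Integrable (fun ω => X (i + k + 1) ω * X (i + k + 1) ω -
        2 * r k * (X (i + 1) ω * X (i + k + 1) ω)) P := (hint _ _).sub ((hint _ _).const_mul _)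
    rw [integral_add hA ((hint _ _).const_mul _),
      integral_sub (hint _ _) ((hint _ _).const_mul _), integral_const_mul, integral_const_mul,
      integral_mul_self_eq_one (hXmeas _) (hstd _), integral_mul_self_eq_one (hXmeas _) (hstd _),
      integral_mul_shift hXmeas hstat]
    simp only [hrdef]; ring
  have hlt : ∀ k, 1 ≤ k → |r k| < 1 := by
    intro k hk
    have h1 : 0 ≤ 1 - r k ^ 2 := by
      rw [← hD 0 k]; exact integral_nonneg fun _ => sq_nonneg _
    rw [← sq_lt_one_iff_abs_lt_one]
    refine lt_of_le_of_ne (by linarith) fun h => ?_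
    have hae : ∀ i, (fun ω => X (i + k + 1) ω) =ᵐ[P] fun ω => r k * X (i + 1) ω := by
      intro i
      have h0 := hD i k
      rw [h, sub_self, integral_eq_zero_iff_of_nonneg (fun _ => sq_nonneg _)] at h0
      · filter_upwards [h0] with ω hω
        exact sub_eq_zero.1 (pow_eq_zero_iff two_ne_zero |>.1 hω)
      · have e : (fun ω => (X (i + k + 1) ω - r k * X (i + 1) ω) ^ 2) =
            fun ω => (X (i + k + 1) ω - r k * X (i + 1) ω) *
              (X (i + k + 1) ω - r k * X (i + 1) ω) := funext fun ω => sq _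
        rw [e]
        have hm := (hL2 (i + k + 1)).sub ((hL2 (i + 1)).const_mul (r k))
        exact hm.integrable_mul hm
    have hone : ∀ j : ℕ, |r (j * k)| = 1 := by
      intro j
      induction j with
      | zero => simp [hrdef, integral_mul_self_eq_one (hXmeas _) (hstd _)]
      | succ j ih =>
        have : r ((j + 1) * k) = r k * r (j * k) := by
          simp only [hrdef]
          rw [← integral_const_mul]
          refine integral_congr_ae ?_
          filter_upwards [hae (j * k)] with ω hω
          rw [add_mul, one_mul]
          rw [hω]; ring
        rw [this, abs_mul, ih, mul_one, (sq_eq_sq_iff_abs_eq_abs (r k) 1).1 (by rw [h, one_pow]), abs_one]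
    have hlim : Tendsto (fun j : ℕ => |r (j * k)|) atTop (nhds |0|) :=
      (hr.comp (tendsto_id.atTop_mul_const' hk)).abs
    simp only [hone, abs_zero] at hlim
    exact one_ne_zero (tendsto_nhds_unique tendsto_const_nhds hlim)
  obtain ⟨N, hN⟩ := eventually_atTop.1 (hr.abs.eventually_le_const
    (show |(0 : ℝ)| < 1 / 2 by norm_num))
  have : ∀ M : ℕ, ∃ δ : ℝ, 1 / 2 ≤ δ ∧ δ < 1 ∧ ∀ k, 1 ≤ k → k < M → |r k| ≤ δ := by
    intro M
    induction M with
    | zero => exact ⟨1 / 2, le_rfl, by norm_num, fun k _ h => absurd h (by omega)⟩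
    | succ M ih =>
      obtain ⟨δ, h1, h2, h3⟩ := ih
      rcases Nat.eq_zero_or_pos M with hM | hM
      · exact ⟨δ, h1, h2, fun k hk hk' => by omega⟩
      refine ⟨max δ |r M|, h1.trans (le_max_left _ _), max_lt h2 (hlt M hM), fun k hk hk' => ?_⟩
      rcases Nat.lt_succ_iff_lt_or_eq.1 hk' with h | rfl
      · exact (h3 k hk h).trans (le_max_left _ _)
      · exact le_max_right _ _
  obtain ⟨δ, h1, h2, h3⟩ := this N
  refine ⟨δ, by linarith, h2, fun k hk => ?_⟩
  rcases lt_or_ge k N with h | h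
  · exact h3 k hk h
  · exact (hN k h).trans h1

lemma sum_erase_dist_le {n : ℕ} {F : ℕ → ℝ} (hF : ∀ k, 0 ≤ F k) (i : Fin n) :
    ∑ j ∈ Finset.univ.erase i, F (Nat.dist i j) ≤ 2 * ∑ k ∈ Finset.Icc 1 n, F k := by
  have key : ∀ (s : Finset (Fin n)), (∀ j ∈ s, j ≠ i) →
      (∀ j ∈ s, ∀ j' ∈ s, Nat.dist i j = Nat.dist i j' → j = j') →
      ∑ j ∈ s, F (Nat.dist i j) ≤ ∑ k ∈ Finset.Icc 1 n, F k := by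
    intro s hs hinj
    rw [← Finset.sum_image (f := F) (g := fun j : Fin n => Nat.dist i j) hinj]
    refine Finset.sum_le_sum_of_subset_of_nonneg (fun k hk => ?_) fun k _ _ => hF k
    obtain ⟨j, hj, rfl⟩ := Finset.mem_image.1 hk
    have h1 := hs j hj
    rw [Finset.mem_Icc, Nat.dist]
    have : (j : ℕ) ≠ i := fun h => h1 (Fin.ext h)
    omega
  rw [two_mul, ← Finset.sum_filter_add_sum_filter_not _ fun j => j < i]
  refine add_le_add (key _ ?_ ?_) (key _ ?_ ?_)
  · exact fun j hj => Finset.ne_of_mem_erase (Finset.mem_filter.1 hj).1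
  · intro j hj j' hj' h
    have h1 := (Finset.mem_filter.1 hj).2
    have h2 := (Finset.mem_filter.1 hj').2
    rw [Nat.dist, Nat.dist] at h
    ext; omega
  · exact fun j hj => Finset.ne_of_mem_erase (Finset.mem_filter.1 hj).1
  · intro j hj j' hj' h
    have h1 := (Finset.mem_filter.1 hj).2
    have h2 := (Finset.mem_filter.1 hj').2
    rw [Nat.dist, Nat.dist] at h
    ext; omega

lemma hasGaussianLaw_pi_gaussianReal (ι : Type*) [Fintype ι] :
    HasGaussianLaw (fun ω : ι → ℝ => fun i => ω i)
      (Measure.pi fun _ : ι => gaussianReal 0 1) := by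
  refine iIndepFun.hasGaussianLaw (X := fun i (ω : ι → ℝ) => ω i) (fun i => ⟨?_⟩) ?_
  · change IsGaussian ((Measure.pi fun _ : ι => gaussianReal 0 1).map (Function.eval i))
    rw [(measurePreserving_eval (fun _ : ι => gaussianReal 0 1) i).map_eq]
    infer_instance
  · exact iIndepFun_pi (X := fun _ x => x) fun _ => aemeasurable_id

lemma hasGaussianLaw_equicorrelated (ι : Type*) [Fintype ι] (a b : ℝ) :
    HasGaussianLaw (fun (p : ℝ × (ι → ℝ)) i => a * p.1 + b * p.2 i)
      ((gaussianReal 0 1).prod (Measure.pi fun _ : ι => gaussianReal 0 1)) := by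
  have h : HasGaussianLaw (fun p : ℝ × (ι → ℝ) => (p.1, fun i => p.2 i))
      ((gaussianReal 0 1).prod (Measure.pi fun _ : ι => gaussianReal 0 1)) := by
    refine IndepFun.hasGaussianLaw ⟨?_⟩ ⟨?_⟩ ?_
    · rw [measurePreserving_fst.map_eq]; infer_instance
    · have := (hasGaussianLaw_pi_gaussianReal ι).isGaussian_map
      rw [← (measurePreserving_snd (μ := gaussianReal 0 1)
        (ν := Measure.pi fun _ : ι => gaussianReal 0 1)).map_eq,
        Measure.map_map (by fun_prop) (by fun_prop)] at this
      exact this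
    · exact indepFun_prod (X := fun x : ℝ => x) (Y := fun ω : ι → ℝ => fun i => ω i)
        measurable_id (by fun_prop)
  let L : ℝ × (ι → ℝ) →L[ℝ] (ι → ℝ) := ContinuousLinearMap.pi fun i =>
    a • ContinuousLinearMap.fst ℝ ℝ (ι → ℝ) +
      b • (ContinuousLinearMap.proj i).comp (ContinuousLinearMap.snd ℝ ℝ (ι → ℝ))
  simpa [L] using h.map_fun L

lemma integral_equicorrelated (ι : Type*) [Fintype ι] (a b : ℝ) (i : ι) :
    ∫ p : ℝ × (ι → ℝ), (a * p.1 + b * p.2 i)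
      ∂((gaussianReal 0 1).prod (Measure.pi fun _ : ι => gaussianReal 0 1)) = 0 := by
  have h1 : MemLp (fun x : ℝ => x) 1 (gaussianReal 0 1) := memLp_id_gaussianReal 1
  have hx := (h1.integrable le_rfl).comp_fst (Measure.pi fun _ : ι => gaussianReal 0 1)
  have he := measurePreserving_eval (fun _ : ι => gaussianReal 0 1) i
  have hy : Integrable (fun p : ℝ × (ι → ℝ) => p.2 i)
      ((gaussianReal 0 1).prod (Measure.pi fun _ : ι => gaussianReal 0 1)) :=
    ((he.integrable_comp (g := fun x : ℝ => x) (by fun_prop)).2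
    (h1.integrable le_rfl)).comp_snd (gaussianReal 0 1)
  rw [integral_add (hx.const_mul a) (hy.const_mul b), integral_const_mul, integral_const_mul,
    integral_fun_fst (f := fun x : ℝ => x), integral_fun_snd (f := fun ω : ι → ℝ => ω i)]
  have : ∫ ω : ι → ℝ, ω i ∂Measure.pi (fun _ : ι => gaussianReal 0 1) = 0 := by
    have := integral_map (μ := Measure.pi fun _ : ι => gaussianReal 0 1) he.aemeasurable
      (f := fun x : ℝ => x) (by fun_prop)
    rw [he.map_eq, integral_id_gaussianReal] at this
    exact this.symm
  rw [this, integral_id_gaussianReal]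
  simp

lemma covariance_equicorrelated (ι : Type*) [Fintype ι] (a b : ℝ) (i j : ι) :
    cov[fun p : ℝ × (ι → ℝ) => a * p.1 + b * p.2 i, fun p => a * p.1 + b * p.2 j;
      (gaussianReal 0 1).prod (Measure.pi fun _ : ι => gaussianReal 0 1)] =
      a ^ 2 + if i = j then b ^ 2 else 0 := by
  set Q := Measure.pi fun _ : ι => gaussianReal 0 1 with hQ
  have he := fun i : ι => measurePreserving_eval (fun _ : ι => gaussianReal 0 1) i
  have h2 : MemLp (fun x : ℝ => x) 2 (gaussianReal 0 1) := memLp_id_gaussianReal 2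
  have hx : MemLp (fun p : ℝ × (ι → ℝ) => p.1) 2 ((gaussianReal 0 1).prod Q) :=
    h2.comp_measurePreserving measurePreserving_fst
  have hy : ∀ i, MemLp (fun p : ℝ × (ι → ℝ) => p.2 i) 2 ((gaussianReal 0 1).prod Q) := fun i =>
    (h2.comp_measurePreserving (he i)).comp_measurePreserving measurePreserving_snd
  have hm : ∀ i, MeasurePreserving (fun p : ℝ × (ι → ℝ) => p.2 i) ((gaussianReal 0 1).prod Q)
      (gaussianReal 0 1) := fun i => (he i).comp measurePreserving_snd
  have hvar : ∀ {f : ℝ × (ι → ℝ) → ℝ},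
      MeasurePreserving f ((gaussianReal 0 1).prod Q) (gaussianReal 0 1) →
      cov[f, f; (gaussianReal 0 1).prod Q] = 1 := fun {f} hf => by
    have h := variance_map (μ := (gaussianReal 0 1).prod Q) (X := fun x : ℝ => x) (Y := f)
      (by fun_prop) hf.aemeasurable
    rw [covariance_self hf.aemeasurable]
    rw [hf.map_eq, variance_fun_id_gaussianReal] at h
    exact h.symm
  have h0 : ∀ i, cov[fun p : ℝ × (ι → ℝ) => p.1, fun p => p.2 i; (gaussianReal 0 1).prod Q] = 0 :=
    fun i => (indepFun_prod (X := fun x : ℝ => x) (Y := fun ω : ι → ℝ => ω i) measurable_id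
      (measurable_pi_apply i)).covariance_eq_zero hx (hy i)
  have hij : i ≠ j → cov[fun p : ℝ × (ι → ℝ) => p.2 i, fun p => p.2 j;
      (gaussianReal 0 1).prod Q] = 0 := fun hne => by
    refine IndepFun.covariance_eq_zero ?_ (hy i) (hy j)
    have hI : iIndepFun (fun i (ω : ι → ℝ) => ω i) Q :=
      iIndepFun_pi (X := fun _ x => x) fun _ => aemeasurable_id
    rw [indepFun_iff_map_prod_eq_prod_map_map (hm i).aemeasurable (hm j).aemeasurable,
      (hm i).map_eq, (hm j).map_eq]
    have := (indepFun_iff_map_prod_eq_prod_map_map (he i).aemeasurable (he j).aemeasurable).1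
      (hI.indepFun hne)
    rw [(he i).map_eq, (he j).map_eq] at this
    rw [← this, ← hQ, ← (measurePreserving_snd (μ := gaussianReal 0 1) (ν := Q)).map_eq,
      Measure.map_map (by fun_prop) (by fun_prop), measurePreserving_snd.map_eq]
    rfl
  rw [covariance_rotation hx hx (hy i) (hy j) (h0 j) (by rw [covariance_comm]; exact h0 i),
    hvar measurePreserving_fst]
  split_ifs with h
  · subst h; rw [hvar (hm i)]; ring
  · rw [hij h]; ring

/-- Conditionally on the common component an equicorrelated vector has independent entries. -/
lemma integral_prod_equicorrelated (ι : Type*) [Fintype ι] (a b : ℝ) {f : ι → ℝ → ℝ}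
    (hf : ∀ i, Measurable (f i)) (hf1 : ∀ i x, |f i x| ≤ 1) :
    ∫ p : ℝ × (ι → ℝ), ∏ i, f i (a * p.1 + b * p.2 i)
      ∂((gaussianReal 0 1).prod (Measure.pi fun _ : ι => gaussianReal 0 1)) =
    ∫ z, ∏ i, ∫ ξ, f i (a * z + b * ξ) ∂gaussianReal 0 1 ∂gaussianReal 0 1 := by
  rw [integral_prod]
  · congr 1; ext z
    exact integral_fintype_prod_eq_prod (fun i ξ => f i (a * z + b * ξ))
  · refine Integrable.of_bound (C := 1) ?_ (ae_of_all _ fun p => ?_)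
    · exact (Finset.measurable_fun_prod _ fun i _ =>
        (hf i).comp (by fun_prop)).aestronglyMeasurable
    · rw [norm_eq_abs, Finset.abs_prod]
      exact Finset.prod_le_one (fun _ _ => abs_nonneg _) fun i _ => hf1 i _

/-- The probability that an entry of the equicorrelated Gaussian vector with correlation
`γ / log n` exceeds `u_n(x)`, given that the common component equals `z`. -/
noncomputable def condTail (γ : ℝ) (n : ℕ) (x z : ℝ) : ℝ :=
  (gaussianReal 0 1).real {ξ | un n x < √(γ / log n) * z + √(1 - γ / log n) * ξ}

lemma measurable_step (α β u v : ℝ) : Measurable fun x : ℝ =>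
    (1 - (α * if u < x then 1 else 0) - β * if v < x then 1 else 0) :=
  (measurable_const.sub ((Measurable.ite measurableSet_Ioi measurable_const
    measurable_const).const_mul _)).sub
    ((Measurable.ite measurableSet_Ioi measurable_const measurable_const).const_mul _)

lemma abs_step_le_one {α β : ℝ} (hα : 0 ≤ α) (hβ : 0 ≤ β) (hαβ : α + β ≤ 1) (u v x : ℝ) :
    |1 - (α * if u < x then 1 else 0) - β * if v < x then 1 else 0| ≤ 1 := by
  rw [abs_le]
  split_ifs <;> constructor <;> linarith

lemma integral_step_eq_condTail (γ : ℝ) (n : ℕ) (x y z α β : ℝ) :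
    ∫ ξ, (1 - (α * if un n x < √(γ / log n) * z + √(1 - γ / log n) * ξ then 1 else 0) -
      β * if un n y < √(γ / log n) * z + √(1 - γ / log n) * ξ then 1 else 0) ∂gaussianReal 0 1 =
    1 - α * condTail γ n x z - β * condTail γ n y z := by
  have hms : ∀ x, MeasurableSet {ξ : ℝ | un n x < √(γ / log n) * z + √(1 - γ / log n) * ξ} :=
    fun x => measurableSet_lt measurable_const (by fun_prop)
  have hind : ∀ x : ℝ, (fun ξ : ℝ => if un n x < √(γ / log n) * z + √(1 - γ / log n) * ξ
      then (1 : ℝ) else 0) =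
      Set.indicator {ξ : ℝ | un n x < √(γ / log n) * z + √(1 - γ / log n) * ξ} 1 := fun x => by
    ext ξ; simp [Set.indicator_apply]
  have hi : ∀ x, Integrable (fun ξ : ℝ => if un n x < √(γ / log n) * z + √(1 - γ / log n) * ξ
      then (1 : ℝ) else 0) (gaussianReal 0 1) := fun x => by
    rw [hind]; exact (integrable_const 1).indicator (hms x)
  have hI : ∀ x, ∫ ξ, (if un n x < √(γ / log n) * z + √(1 - γ / log n) * ξ then (1 : ℝ) else 0)
      ∂gaussianReal 0 1 = condTail γ n x z := fun x => by
    rw [hind, integral_indicator_one (hms x), condTail]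
  have h1 : Integrable (fun ξ : ℝ => 1 -
      α * if un n x < √(γ / log n) * z + √(1 - γ / log n) * ξ then 1 else 0) (gaussianReal 0 1) :=
    (integrable_const 1).sub ((hi x).const_mul α)
  rw [integral_sub h1 ((hi y).const_mul β), integral_sub (integrable_const 1) ((hi x).const_mul α),
    integral_const_mul, integral_const_mul, hI, hI]
  simp

/-- Uniformly over the coefficients, products of two-step functions of the first `n` terms have
asymptotically the same mean as for the equicorrelated vector with correlation `γ / log n`. -/
lemma exists_tendsto_abs_integral_prod_sub_le {Ω : Type*} [MeasurableSpace Ω] {P : Measure Ω}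
    [IsProbabilityMeasure P] {X : ℕ → Ω → ℝ} {γ : ℝ} (hγ : 0 ≤ γ) (hXmeas : ∀ n, Measurable (X n))
    (hGauss : ∀ (m : ℕ) (idx : Fin m → ℕ) (c : Fin m → ℝ), ∃ v : ℝ≥0,
      Measure.map (fun ω => ∑ i, c i * X (idx i) ω) P = gaussianReal 0 v)
    (hstd : ∀ n, Measure.map (X n) P = gaussianReal 0 1) (hstat : ∀ (m k : ℕ),
      Measure.map (fun ω => fun i : Fin m => X (i.1 + 1 + k) ω) P =
        Measure.map (fun ω => fun i : Fin m => X (i.1 + 1) ω) P)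
    (hr : Tendsto (fun n : ℕ => (∫ ω, X 1 ω * X (n + 1) ω ∂P) * Real.log n)
      atTop (nhds γ)) {x y : ℝ} (hxy : x ≤ y) :
    ∃ e : ℕ → ℝ, Tendsto e atTop (nhds 0) ∧ ∀ᶠ n : ℕ in atTop, ∀ α β : Fin n → ℝ,
      (∀ i, 0 ≤ α i) → (∀ i, 0 ≤ β i) → (∀ i, α i + β i ≤ 1) →
      |∫ ω, ∏ i : Fin n, (1 - (α i * if un n x < X (i + 1) ω then 1 else 0) -
          β i * if un n y < X (i + 1) ω then 1 else 0) ∂P -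
        ∫ z, ∏ i, (1 - α i * condTail γ n x z - β i * condTail γ n y z) ∂gaussianReal 0 1| ≤
          e n := by
  set r : ℕ → ℝ := fun n => ∫ ω, X 1 ω * X (n + 1) ω ∂P with hrdef
  have hr0 : Tendsto r atTop (nhds 0) := by
    have := hr.mul tendsto_log_natCast_atTop.inv_tendsto_atTop
    rw [mul_zero] at this
    refine this.congr' ?_
    filter_upwards [tendsto_log_natCast_atTop.eventually_gt_atTop 0] with n hn
    simp [hn.ne', hrdef]
  obtain ⟨δ, hδ0, hδ1, hδ⟩ := exists_abs_covariance_le hXmeas hstd hstat hr0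
  set K := (2 * π * √(1 - δ ^ 2))⁻¹ with hK
  have hK0 : 0 ≤ K := by positivity
  refine ⟨fun n => π * K * ((n : ℝ) * ∑ k ∈ Finset.Icc 1 n, |r k - γ / log n| *
      exp (-(un n x ^ 2 / (1 + max |r k| (γ / log n))))), ?_, ?_⟩
  · simpa using (tendsto_covariance_sum hγ hr hδ0 hδ1 hδ (x := x)).const_mul (π * K)
  filter_upwards [(tendsto_log_natCast_atTop.const_div_atTop γ).eventually_le_const hδ0,
    (tendsto_un_atTop x).eventually_ge_atTop 0, tendsto_log_natCast_atTop.eventually_gt_atTop 0]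
    with n hρδ hu hL α β hα hβ hαβ
  set ρ := γ / log (n : ℝ) with hρ
  have hρ0 : 0 ≤ ρ := by positivity
  have hX0 : ∀ i, ∫ ω, X i ω ∂P = 0 := fun i =>
    integral_eq_zero_of_map_eq_gaussianReal (hXmeas i) (hstd i)
  have hL2 : ∀ n, MemLp (X n) 2 P := fun n => memLp_two_of_map_eq_gaussianReal (hstd n)
  have hcX : ∀ i j, cov[X i, X j; P] = ∫ ω, X i ω * X j ω ∂P := fun i j => by
    rw [covariance_eq_sub (hL2 i) (hL2 j), hX0]; simp
  have hcX' : ∀ i j : Fin n, cov[X (i + 1), X (j + 1); P] = r (Nat.dist i j) := by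
    intro i j
    rcases le_total (i : ℕ) j with h | h
    · have h2 := integral_mul_shift hXmeas hstat i (j - i)
      rw [Nat.add_sub_cancel' h] at h2
      rw [hcX, h2, Nat.dist_eq_sub_of_le h]
    · have h2 := integral_mul_shift hXmeas hstat j (i - j)
      rw [Nat.add_sub_cancel' h] at h2
      rw [covariance_comm, hcX, h2, Nat.dist_eq_sub_of_le_right h]
  set Y : Fin n → ℝ × (Fin n → ℝ) → ℝ := fun i p => √ρ * p.1 + √(1 - ρ) * p.2 i with hY
  have hcY : ∀ i j, cov[Y i, Y j; (gaussianReal 0 1).prod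
      (Measure.pi fun _ : Fin n => gaussianReal 0 1)] = ρ + if i = j then 1 - ρ else 0 :=
    fun i j => by
      rw [hY, covariance_equicorrelated, sq_sqrt hρ0, sq_sqrt (by linarith)]
      congr
  have hdist : ∀ i j : Fin n, i ≠ j → 1 ≤ Nat.dist i j := fun i j hij =>
    Nat.dist_pos_of_ne fun h => hij (Fin.ext h)
  have key := abs_integral_prod_step_sub_le' (X := fun (i : Fin n) => X (i + 1)) (Y := Y)
    (P := P) (Q := (gaussianReal 0 1).prod (Measure.pi fun _ : Fin n => gaussianReal 0 1))
    (w := fun i j => max |r (Nat.dist i j)| ρ) (δ := δ) (u := un n x) (v := un n y) (α := α)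
    (β := β)
    (hasGaussianLaw_of_linearCombination hXmeas hGauss n fun i => i + 1)
    (hasGaussianLaw_equicorrelated _ _ _) (fun i => hXmeas _) (fun i => by simp only [hY]; fun_prop)
    (fun i => hX0 _) (fun i => integral_equicorrelated _ _ _ i)
    (fun i => by rw [hcX, integral_mul_self_eq_one (hXmeas _) (hstd _)])
    (fun i => by rw [hcY]; simp) (fun i j _ => by rw [hcX']; exact le_max_left _ _)
    (fun i j hij => by
      rw [hcY, if_neg hij, add_zero, abs_of_nonneg hρ0]; exact le_max_right _ _)
    (fun i j hij => max_le (hδ _ (hdist i j hij)) hρδ) hδ1 hu (un_mono hxy) hα hβ hαβ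
  rw [integral_prod_equicorrelated (Fin n) (√ρ) (√(1 - ρ))
    (f := fun i x' => 1 - (α i * if un n x < x' then 1 else 0) -
      β i * if un n y < x' then 1 else 0) (fun i => measurable_step _ _ _ _)
    (fun i x' => abs_step_le_one (hα i) (hβ i) (hαβ i) _ _ _)] at key
  simp only [hρ, integral_step_eq_condTail] at key
  refine key.trans ?_
  rw [← hρ]
  set F : ℕ → ℝ := fun k => |r k - ρ| * (K * exp (-(un n x ^ 2 / (1 + max |r k| ρ)))) with hF
  have hF0 : ∀ k, 0 ≤ F k := fun k => by positivity
  calc _ = π / 2 * ∑ i : Fin n, ∑ j ∈ Finset.univ.erase i, F (Nat.dist i j) := by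
        congr 1
        refine Finset.sum_congr rfl fun i _ => Finset.sum_congr (by congr!) fun j hj => ?_
        rw [hcX', hcY, if_neg (Finset.ne_of_mem_erase hj).symm, add_zero]
    _ ≤ π / 2 * ∑ i : Fin n, 2 * ∑ k ∈ Finset.Icc 1 n, F k := by
        gcongr with i
        exact sum_erase_dist_le hF0 i
    _ = π * K * ((n : ℝ) * ∑ k ∈ Finset.Icc 1 n, |r k - ρ| *
          exp (-(un n x ^ 2 / (1 + max |r k| ρ)))) := by
        rw [Finset.sum_const, Finset.card_univ, Fintype.card_fin, nsmul_eq_mul]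
        have : ∑ k ∈ Finset.Icc 1 n, F k = K * ∑ k ∈ Finset.Icc 1 n, |r k - ρ| *
            exp (-(un n x ^ 2 / (1 + max |r k| ρ))) := by
          rw [Finset.mul_sum]
          exact Finset.sum_congr rfl fun k _ => by simp only [hF]; ring
        rw [this]; ring

lemma gaussianReal_real_Ioi_eq (w : ℝ) :
    (gaussianReal 0 1).real (Set.Ioi w) =
      (∫ t in Set.Ioi 0, gaussianPDFReal 0 1 t) - ∫ t in (0 : ℝ)..w, gaussianPDFReal 0 1 t := by
  have hi := integrable_gaussianPDFReal 0 1
  rw [measureReal_def, gaussianReal_apply_eq_integral _ one_ne_zero, ENNReal.toReal_ofReal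
    (integral_nonneg fun _ => gaussianPDFReal_nonneg _ _ _),
    ← intervalIntegral.integral_Ioi_sub_Ioi' hi.integrableOn hi.integrableOn]
  ring

lemma continuous_gaussianPDFReal_std : Continuous (gaussianPDFReal 0 1) := by
  rw [gaussianPDFReal_def]; fun_prop

lemma hasDerivAt_gaussianReal_real_Ioi (w : ℝ) :
    HasDerivAt (fun w => (gaussianReal 0 1).real (Set.Ioi w)) (-gaussianPDFReal 0 1 w) w := by
  simp_rw [gaussianReal_real_Ioi_eq]
  exact (intervalIntegral.integral_hasDerivAt_right
    (integrable_gaussianPDFReal 0 1).intervalIntegrable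
    (stronglyMeasurable_gaussianPDFReal 0 1).stronglyMeasurableAtFilter
    continuous_gaussianPDFReal_std.continuousAt).const_sub _

lemma tendsto_gaussianReal_real_Ioi :
    Tendsto (fun w => (gaussianReal 0 1).real (Set.Ioi w)) atTop (nhds 0) := by
  have h := intervalIntegral_tendsto_integral_Ioi (μ := volume) 0
    (integrable_gaussianPDFReal 0 1).integrableOn tendsto_id
  simp_rw [gaussianReal_real_Ioi_eq]
  simpa using h.const_sub (∫ t in Set.Ioi 0, gaussianPDFReal 0 1 t)

/-- Mills' ratio asymptotics. -/
lemma tendsto_gaussianReal_real_Ioi_div :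
    Tendsto (fun w => (gaussianReal 0 1).real (Set.Ioi w) / (gaussianPDFReal 0 1 w / w)) atTop
      (nhds 1) := by
  have hpos : ∀ w, 0 < gaussianPDFReal 0 1 w := fun w => gaussianPDFReal_pos _ _ _ one_ne_zero
  have hd : ∀ᶠ w in atTop, HasDerivAt (fun w => gaussianPDFReal 0 1 w / w)
      (-gaussianPDFReal 0 1 w * (1 + (w ^ 2)⁻¹)) w := by
    filter_upwards [eventually_gt_atTop 0] with w hw
    have := (hasDerivAt_gaussianPDFReal_zero one_ne_zero w).div (hasDerivAt_id w) hw.ne'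
    refine this.congr_deriv ?_
    simp only [NNReal.coe_one, id]
    field_simp
    ring
  refine HasDerivAt.lhopital_zero_atTop (Eventually.of_forall hasDerivAt_gaussianReal_real_Ioi)
    hd (Eventually.of_forall fun w => ?_) tendsto_gaussianReal_real_Ioi ?_ ?_
  · have := hpos w
    exact (mul_neg_of_neg_of_pos (neg_neg_of_pos this) (by positivity)).ne
  · have h1 : Tendsto (fun w : ℝ => (√(2 * π))⁻¹ * w⁻¹) atTop (nhds 0) := by
      simpa using tendsto_inv_atTop_zero.const_mul (√(2 * π))⁻¹
    refine squeeze_zero' ?_ ?_ h1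
    · filter_upwards [eventually_gt_atTop 0] with w hw
      exact div_nonneg (hpos w).le hw.le
    · filter_upwards [eventually_gt_atTop 0] with w hw
      rw [div_eq_mul_inv, gaussianPDFReal]
      gcongr
      simp only [NNReal.coe_one, mul_one, sub_zero]
      refine mul_le_of_le_one_right (by positivity) (exp_le_one_iff.2 ?_)
      have := sq_nonneg w
      linarith
  · have h1 : Tendsto (fun w : ℝ => (1 + (w ^ 2)⁻¹)⁻¹) atTop (nhds 1) := by
      have : Tendsto (fun w : ℝ => (w ^ 2)⁻¹) atTop (nhds 0) :=
        (tendsto_pow_atTop two_ne_zero).inv_tendsto_atTop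
      simpa using (this.const_add 1).inv₀ (by norm_num)
    refine h1.congr fun w => ?_
    have := (hpos w).ne'
    have h3 : 1 + (w ^ 2)⁻¹ ≠ 0 := by positivity
    field_simp

/-- The conditional tail of the equicorrelated model has the Gumbel-type limit. -/
lemma tendsto_mul_condTail {γ : ℝ} (hγ : 0 ≤ γ) (x z : ℝ) :
    Tendsto (fun n : ℕ => n * condTail γ n x z) atTop (nhds (g γ x z)) := by
  set a : ℕ → ℝ := fun n => √(2 * log n) with ha
  set s : ℕ → ℝ := fun n => log (log n) + log (4 * π) with hs
  set c : ℕ → ℝ := fun n => (x - s n / 2) / a n with hc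
  set ρ : ℕ → ℝ := fun n => γ / log n with hρ
  set w : ℕ → ℝ := fun n => (un n x - √(ρ n) * z) / √(1 - ρ n) with hw
  have hLtop := tendsto_log_natCast_atTop
  have hatop : Tendsto a atTop atTop := tendsto_sqrt_two_mul_log_atTop
  have hc0 : Tendsto c atTop (nhds 0) := tendsto_un_correction x
  have hρ0 : Tendsto ρ atTop (nhds 0) := hLtop.const_div_atTop γ
  have hsρ0 : Tendsto (fun n => √(ρ n)) atTop (nhds 0) := by
    simpa using hρ0.sqrt
  have hs1 : Tendsto (fun n => √(1 - ρ n)) atTop (nhds 1) := by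
    simpa using (hρ0.const_sub 1).sqrt
  have hwa : Tendsto (fun n => w n / a n) atTop (nhds 1) := by
    have h1 : Tendsto (fun n => (1 + (c n - √(ρ n) * z) * (a n)⁻¹) / √(1 - ρ n)) atTop
        (nhds ((1 + (0 - 0 * z) * 0) / 1)) :=
      (((hc0.sub (hsρ0.mul_const z)).mul hatop.inv_tendsto_atTop).const_add 1).div hs1 one_ne_zero
    rw [zero_mul, sub_zero, mul_zero, add_zero, div_one] at h1
    refine h1.congr' ?_
    filter_upwards [hatop.eventually_gt_atTop 0] with n hn
    simp only [hw]
    rw [un_eq]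
    change _ = (a n + c n - √(ρ n) * z) / √(1 - ρ n) / a n
    field_simp
    ring
  have hwtop : Tendsto w atTop atTop := by
    refine (hwa.pos_mul_atTop one_pos hatop).congr' ?_
    filter_upwards [hatop.eventually_gt_atTop 0] with n hn
    field_simp
  have huρ : Tendsto (fun n => un n x * √(ρ n)) atTop (nhds √(2 * γ)) := by
    have h1 : Tendsto (fun n => √(2 * γ) + c n * √(ρ n)) atTop (nhds (√(2 * γ) + 0 * 0)) :=
      (hc0.mul hsρ0).const_add _
    rw [mul_zero, add_zero] at h1
    refine h1.congr' ?_
    filter_upwards [hLtop.eventually_gt_atTop 0] with n hn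
    have : a n * √(ρ n) = √(2 * γ) := by
      rw [ha, hρ, ← sqrt_mul (by positivity)]
      congr 1
      field_simp
    rw [← this, un_eq]
    change _ = (a n + c n) * _
    ring
  have hexp : Tendsto (fun n : ℕ => log n - s n / 2 - w n ^ 2 / 2) atTop
      (nhds (-x - γ + √(2 * γ) * z)) := by
    have h1 : Tendsto (fun n => -(2 * x + c n ^ 2 - 2 * (un n x * √(ρ n)) * z + ρ n * z ^ 2 +
        (un n x * √(ρ n) - ρ n * z) ^ 2 / (1 - ρ n)) / 2) atTop
        (nhds (-(2 * x + 0 ^ 2 - 2 * √(2 * γ) * z + 0 * z ^ 2 +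
          (√(2 * γ) - 0 * z) ^ 2 / (1 - 0)) / 2)) := by
      refine Tendsto.div_const (Tendsto.neg ?_) 2
      refine ((((hc0.pow 2).const_add (2 * x)).sub ((huρ.const_mul 2).mul_const z)).add
        (hρ0.mul_const (z ^ 2))).add ?_
      exact ((huρ.sub (hρ0.mul_const z)).pow 2).div (hρ0.const_sub 1) (by norm_num)
    have e : -(2 * x + 0 ^ 2 - 2 * √(2 * γ) * z + 0 * z ^ 2 +
          (√(2 * γ) - 0 * z) ^ 2 / (1 - 0)) / 2 = -x - γ + √(2 * γ) * z := by
      have := sq_sqrt (show 0 ≤ 2 * γ by positivity)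
      rw [zero_mul, zero_mul, sub_zero, sub_zero, this]; ring
    rw [e] at h1
    refine h1.congr' ?_
    filter_upwards [hLtop.eventually_gt_atTop 0, hρ0.eventually_lt_const one_pos] with n hn hρn
    have h3 : 0 ≤ ρ n := by simp only [hρ]; positivity
    have h4 : 0 < 1 - ρ n := by linarith
    have h5 : √(1 - ρ n) ^ 2 = 1 - ρ n := sq_sqrt h4.le
    have h6 : √(ρ n) ^ 2 = ρ n := sq_sqrt h3
    have h7 : un n x ^ 2 = 2 * log n + 2 * x - s n + c n ^ 2 := un_sq_eq hn x
    have h8 : w n ^ 2 = (un n x - √(ρ n) * z) ^ 2 +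
        (un n x * √(ρ n) - ρ n * z) ^ 2 / (1 - ρ n) := by
      have : (un n x * √(ρ n) - ρ n * z) ^ 2 = ρ n * (un n x - √(ρ n) * z) ^ 2 := by
        nth_rewrite 3 [← h6]
        nth_rewrite 2 [← h6]
        ring
      rw [this, hw]
      simp only
      rw [div_pow, h5]
      field_simp
      ring
    have h9 : (un n x - √(ρ n) * z) ^ 2 =
        un n x ^ 2 - 2 * (un n x * √(ρ n)) * z + ρ n * z ^ 2 := by
      rw [sub_sq, mul_pow, h6]; ring
    rw [h8, h9, h7]
    ring
  have hmain := (tendsto_gaussianReal_real_Ioi_div.comp hwtop).mul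
    ((hwa.inv₀ one_ne_zero).mul hexp.rexp)
  rw [inv_one, one_mul, one_mul] at hmain
  refine hmain.congr' ?_
  filter_upwards [hLtop.eventually_gt_atTop 0, hρ0.eventually_lt_const one_pos,
    hwtop.eventually_gt_atTop 0, hatop.eventually_gt_atTop 0] with n hn hρn hwn han
  have hn0 : 0 < (n : ℝ) := by
    rcases Nat.eq_zero_or_pos n with h | h
    · simp [h] at hn
    · exact_mod_cast h
  have h5 : 0 < √(1 - ρ n) := sqrt_pos.2 (by linarith)
  have hset : condTail γ n x z = (gaussianReal 0 1).real (Set.Ioi (w n)) := by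
    rw [condTail]
    congr 1
    ext ξ
    simp only [Set.mem_ofPred_eq, Set.mem_Ioi, hw]
    rw [div_lt_iff₀ h5]
    constructor <;> intro h <;> simp only [hρ] at * <;> linarith
  have hpdf : exp (log n - s n / 2 - w n ^ 2 / 2) = n * gaussianPDFReal 0 1 (w n) / a n := by
    rw [exp_sub, exp_sub, exp_log hn0, gaussianPDFReal]
    have e1 : exp (s n / 2) = a n * √(2 * π) := by
      have : s n / 2 = log (a n * √(2 * π)) := by
        rw [ha, ← sqrt_mul (by positivity), log_sqrt (by positivity)]
        simp only [hs]
        rw [show 2 * log (n : ℝ) * (2 * π) = log n * (4 * π) by ring,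
          log_mul hn.ne' (by positivity)]
      rw [this, exp_log (by positivity)]
    rw [e1]
    simp only [NNReal.coe_one, mul_one, sub_zero]
    rw [neg_div, exp_neg]
    field_simp
  have hpos : 0 < gaussianPDFReal 0 1 (w n) := gaussianPDFReal_pos _ _ _ one_ne_zero
  rw [hset, hpdf, Function.comp_apply]
  field_simp

theorem prod_Icc_one_eq_prod_fin {M : Type*} [CommMonoid M] (n : ℕ) (f : ℕ → M) :
    ∏ j ∈ Finset.Icc 1 n, f j = ∏ i : Fin n, f (i + 1) := by
  rw [← Finset.prod_range (fun i => f (i + 1)), ← Finset.Ico_add_one_right_eq_Icc,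
    Finset.prod_Ico_eq_prod_range]
  simp [add_comm]

theorem sum_Icc_one_eq_sum_fin {M : Type*} [AddCommMonoid M] (n : ℕ) (f : ℕ → M) :
    ∑ j ∈ Finset.Icc 1 n, f j = ∑ i : Fin n, f (i + 1) := by
  rw [← Finset.sum_range (fun i => f (i + 1)), ← Finset.Ico_add_one_right_eq_Icc,
    Finset.sum_Ico_eq_sum_range]
  simp [add_comm]

theorem tendsto_zero_of_tendsto_natCast_mul {a : ℕ → ℝ} {A : ℝ}
    (ha : Tendsto (fun n : ℕ => n * a n) atTop (nhds A)) : Tendsto a atTop (nhds 0) := by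
  have h := ha.mul (tendsto_inv_atTop_nhds_zero_nat (𝕜 := ℝ))
  rw [mul_zero] at h
  refine h.congr' ?_
  filter_upwards [eventually_gt_atTop 0] with n hn
  have : (n : ℝ) ≠ 0 := by positivity
  field_simp

theorem tendsto_one_sub_pow {a : ℕ → ℝ} {A l : ℝ} {N φ : ℕ → ℕ} (hφ : Tendsto φ atTop atTop)
    (ha : Tendsto (fun n : ℕ => n * a n) atTop (nhds A))
    (hN : Tendsto (fun i : ℕ => (N i : ℝ) / φ i) atTop (nhds l)) :
    Tendsto (fun i => (1 - a (φ i)) ^ N i) atTop (nhds (exp (-(l * A)))) := by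
  have h1 : Tendsto (fun n : ℕ => (n : ℝ) * (-a n)) atTop (nhds (-A)) := by
    simpa using ha.neg
  have h2 := (Real.tendsto_nat_mul_log_one_add_of_tendsto h1).comp hφ
  have h3 := (hN.mul h2).rexp
  rw [mul_neg] at h3
  refine h3.congr' ?_
  filter_upwards [hφ.eventually_gt_atTop 0,
    hφ.eventually ((tendsto_zero_of_tendsto_natCast_mul ha).eventually_lt_const one_pos)]
    with i hi hai
  have h4 : (φ i : ℝ) ≠ 0 := by positivity
  simp only [Function.comp]
  rw [← mul_assoc, div_mul_cancel₀ _ h4, ← log_pow, exp_log (by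
    have : 0 < 1 + -a (φ i) := by linarith
    positivity), sub_eq_add_neg]

theorem prod_ite_bool_eq {n : ℕ} (b : Fin n → Bool) (A B : ℝ) :
    ∏ i, (if b i then A else B) =
      A ^ (Finset.univ.filter fun i => b i = true).card *
        B ^ (Finset.univ.filter fun i => ¬ b i = true).card := by
  rw [Finset.prod_ite, Finset.prod_const, Finset.prod_const]

/-- Pointwise limit of the conditional generating function along a sequence of sample sizes. -/
theorem tendsto_prod_ite_bool {a b : ℕ → ℝ} {A B l : ℝ} {φ : ℕ → ℕ}
    (hφ : Tendsto φ atTop atTop) (e : ℕ → Bool)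
    (ha : Tendsto (fun n : ℕ => n * a n) atTop (nhds A))
    (hb : Tendsto (fun n : ℕ => n * b n) atTop (nhds B))
    (hl : Tendsto (fun i => (∑ k ∈ Finset.Icc 1 (φ i), (if e k then (1 : ℝ) else 0)) / φ i)
      atTop (nhds l)) :
    Tendsto (fun i => ∏ j : Fin (φ i), (if e (j + 1) then 1 - a (φ i) else 1 - b (φ i))) atTop
      (nhds (exp (-(l * A) - (1 - l) * B))) := by
  have h1 : ∀ n : ℕ, (((Finset.univ (α := Fin n)).filter fun j : Fin _ => e (j + 1) = true).card : ℝ) =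
      ∑ k ∈ Finset.Icc 1 n, (if e k then (1 : ℝ) else 0) := by
    intro n
    rw [sum_Icc_one_eq_sum_fin n (fun k => if e k then (1 : ℝ) else 0), Finset.sum_boole]
  have h2 : ∀ n : ℕ, (((Finset.univ (α := Fin n)).filter
      fun j : Fin _ => ¬ e (j + 1) = true).card : ℝ) =
      n - ∑ k ∈ Finset.Icc 1 n, (if e k then (1 : ℝ) else 0) := by
    intro n
    rw [← h1, eq_sub_iff_add_eq', ← Nat.cast_add, Finset.card_filter_add_card_filter_not]
    simp
  have h3 := tendsto_one_sub_pow (N := fun i => ((Finset.univ (α := Fin (φ i))).filter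
    fun j : Fin _ => e (j + 1) = true).card) hφ ha (hl.congr fun i => by rw [h1])
  have h4 := tendsto_one_sub_pow (N := fun i => ((Finset.univ (α := Fin (φ i))).filter
    fun j : Fin _ => ¬ e (j + 1) = true).card) hφ hb ((hl.const_sub 1).congr' (by
      filter_upwards [hφ.eventually_gt_atTop 0] with i hi
      have : (φ i : ℝ) ≠ 0 := by positivity
      rw [h2, sub_div, div_self this]))
  have h5 := h3.mul h4
  rw [← exp_add, ← sub_eq_add_neg] at h5
  refine h5.congr fun i => ?_
  rw [← prod_ite_bool_eq (fun j : Fin (φ i) => e (j + 1))]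

theorem measurable_condTail (γ : ℝ) (n : ℕ) (x : ℝ) : Measurable (condTail γ n x) := by
  refine (measurable_measure_prodMk_left (ν := gaussianReal 0 1)
    (s := {p : ℝ × ℝ | un n x < √(γ / log n) * p.1 + √(1 - γ / log n) * p.2}) ?_).ennreal_toReal
  exact measurableSet_lt measurable_const (by fun_prop)

lemma condTail_mem_Icc (γ : ℝ) (n : ℕ) (x z : ℝ) : condTail γ n x z ∈ Set.Icc (0 : ℝ) 1 :=
  ⟨measureReal_nonneg, measureReal_le_one⟩

/-- A function of finitely many Boolean random variables is measurable. -/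
lemma measurable_comp_fin_bool {Ω : Type} [MeasurableSpace Ω] {ε : ℕ → Ω → Bool}
    (hεmeas : ∀ n, Measurable (ε n)) (n : ℕ) (G : (Fin n → Bool) → ℝ) :
    Measurable fun ω => G fun i => ε (i + 1) ω :=
  (Measurable.of_discrete (f := G)).comp (measurable_pi_iff.2 fun i => hεmeas (i + 1))

lemma abs_prod_le_one {n : ℕ} {f : Fin n → ℝ} (h : ∀ i, f i ∈ Set.Icc (0 : ℝ) 1) :
    |∏ i, f i| ≤ 1 := by
  rw [abs_of_nonneg (Finset.prod_nonneg fun i _ => (h i).1)]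
  exact Finset.prod_le_one (fun i _ => (h i).1) fun i _ => (h i).2

lemma abs_integral_le_one {α : Type*} [MeasurableSpace α] (μ : Measure α) [IsProbabilityMeasure μ]
    {f : α → ℝ} (h : ∀ a, |f a| ≤ 1) : |∫ a, f a ∂μ| ≤ 1 := by
  simpa using norm_integral_le_of_norm_le_const (μ := μ) (f := f) (C := 1) (ae_of_all _ h)

/-- The limit of the generating function of the averaged conditional exceedance counts. -/
theorem tendsto_integral_integral_prod_condTail
    {Ω : Type} [MeasurableSpace Ω] (P : Measure Ω) [IsProbabilityMeasure P]
    {ε : ℕ → Ω → Bool} {lam : Ω → ℝ} {γ : ℝ} (hγ : 0 ≤ γ)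
    (hεmeas : ∀ n, Measurable (ε n))
    (hS : TendstoInMeasure P
      (fun n ω => (∑ k ∈ Finset.Icc 1 n, (if ε k ω then (1 : ℝ) else 0)) / n) atTop lam)
    (x y : ℝ) {s t : ℝ} (hs : s ∈ Set.Icc (0 : ℝ) 1) (ht : t ∈ Set.Icc (0 : ℝ) 1) :
    Tendsto (fun n : ℕ => ∫ ω, ∫ z, ∏ j : Fin n, (if ε (j + 1) ω then
        1 - ((1 - s) * condTail γ n x z + s * (1 - t) * condTail γ n y z)
        else 1 - (1 - t) * condTail γ n y z) ∂gaussianReal 0 1 ∂P) atTop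
      (nhds (∫ ω, ∫ z, exp (-(lam ω * ((1 - s) * g γ x z + s * (1 - t) * g γ y z)) -
        (1 - lam ω) * ((1 - t) * g γ y z)) ∂gaussianReal 0 1 ∂P)) := by
  have hbound : ∀ (n : ℕ) (ω : Ω) (z : ℝ), |∏ j : Fin n, (if ε (j + 1) ω then
      1 - ((1 - s) * condTail γ n x z + s * (1 - t) * condTail γ n y z)
      else 1 - (1 - t) * condTail γ n y z)| ≤ 1 := by
    intro n ω z
    refine abs_prod_le_one fun i => ?_
    obtain ⟨hx0, hx1⟩ := condTail_mem_Icc γ n x z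
    obtain ⟨hy0, hy1⟩ := condTail_mem_Icc γ n y z
    obtain ⟨hs0, hs1⟩ := hs
    obtain ⟨ht0, ht1⟩ := ht
    have h1 : 0 ≤ (1 - s) * condTail γ n x z := mul_nonneg (by linarith) hx0
    have h2 : 0 ≤ (1 - t) * condTail γ n y z := mul_nonneg (by linarith) hy0
    have h3 : (1 - s) * condTail γ n x z ≤ (1 - s) * 1 :=
      mul_le_mul_of_nonneg_left hx1 (by linarith)
    have h4 : (1 - t) * condTail γ n y z ≤ 1 := by nlinarith
    have h5 : s * (1 - t) * condTail γ n y z ≤ s * 1 := by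
      rw [mul_assoc]; exact mul_le_mul_of_nonneg_left h4 hs0
    have h6 : 0 ≤ s * (1 - t) * condTail γ n y z := by rw [mul_assoc]; exact mul_nonneg hs0 h2
    split_ifs <;> constructor <;> linarith
  refine tendsto_of_subseq_tendsto fun ns hns => ?_
  obtain ⟨ms, hms, hae⟩ := (hS.comp hns).exists_seq_tendsto_ae
  refine ⟨ms, ?_⟩
  have hφ : Tendsto (fun i => ns (ms i)) atTop atTop := hns.comp hms.tendsto_atTop
  refine tendsto_integral_of_dominated_convergence (fun _ => 1) (fun i => ?_)
    (integrable_const _) (fun i => ae_of_all _ fun ω => abs_integral_le_one _ (hbound _ ω)) ?_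
  · exact (measurable_comp_fin_bool hεmeas (ns (ms i)) fun e =>
      ∫ z, ∏ j, (if e j then
        1 - ((1 - s) * condTail γ (ns (ms i)) x z + s * (1 - t) * condTail γ (ns (ms i)) y z)
        else 1 - (1 - t) * condTail γ (ns (ms i)) y z) ∂gaussianReal 0 1).aestronglyMeasurable
  filter_upwards [hae] with ω hω
  refine tendsto_integral_of_dominated_convergence (fun _ => 1) (fun i => ?_)
    (integrable_const _) (fun i => ae_of_all _ fun z => hbound _ ω z) (ae_of_all _ fun z => ?_)
  · refine (Finset.measurable_fun_prod _ fun j _ => ?_).aestronglyMeasurable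
    have h1 := measurable_condTail γ (ns (ms i)) x
    have h2 := measurable_condTail γ (ns (ms i)) y
    split_ifs <;> fun_prop
  · have hx := tendsto_mul_condTail hγ x z
    have hy := tendsto_mul_condTail hγ y z
    refine tendsto_prod_ite_bool
      (a := fun n => (1 - s) * condTail γ n x z + s * (1 - t) * condTail γ n y z)
      (b := fun n => (1 - t) * condTail γ n y z) hφ (fun k => ε k ω) ?_ ?_ hω
    · refine ((hx.const_mul (1 - s)).add (hy.const_mul (s * (1 - t)))).congr fun n => ?_
      ring
    · exact (hy.const_mul (1 - t)).congr fun n => by ring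

/-- Fubini for a bounded function of two independent random elements. -/
theorem integral_eq_integral_integral_of_indepFun {Ω α β : Type*} [MeasurableSpace Ω]
    [MeasurableSpace α] [MeasurableSpace β] {P : Measure Ω} [IsProbabilityMeasure P]
    {f : Ω → α} {h : Ω → β} (hf : Measurable f) (hh : Measurable h) (hind : IndepFun f h P)
    {F : α → β → ℝ} (hF : Measurable (Function.uncurry F)) (hF1 : ∀ a b, |F a b| ≤ 1) :
    ∫ ω, F (f ω) (h ω) ∂P = ∫ ω', ∫ ω, F (f ω) (h ω') ∂P ∂P := by
  have := Measure.isProbabilityMeasure_map (μ := P) hf.aemeasurable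
  have := Measure.isProbabilityMeasure_map (μ := P) hh.aemeasurable
  have h1 := (indepFun_iff_map_prod_eq_prod_map_map hf.aemeasurable hh.aemeasurable).1 hind
  have h2 : ∫ ω, F (f ω) (h ω) ∂P =
      ∫ p, Function.uncurry F p ∂(P.map f).prod (P.map h) := by
    rw [← h1, integral_map (hf.prodMk hh).aemeasurable hF.aestronglyMeasurable]
    rfl
  rw [h2, integral_prod_symm _ (Integrable.of_bound hF.aestronglyMeasurable 1
    (ae_of_all _ fun p => hF1 p.1 p.2))]
  have h3 : StronglyMeasurable fun b => ∫ a, Function.uncurry F (a, b) ∂P.map f :=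
    (hF.comp measurable_swap).stronglyMeasurable.integral_prod_right'
  rw [integral_map hh.aemeasurable h3.aestronglyMeasurable]
  refine integral_congr_ae (ae_of_all _ fun ω' => ?_)
  exact integral_map hf.aemeasurable (hF.comp measurable_prodMk_right).aestronglyMeasurable

/-- The product of the two generating factors of the observed and the total exceedance counts,
expanded as a product over the indices. -/
lemma pow_card_mul_pow_card_eq_prod {u v : ℝ} (huv : u ≤ v) (s t : ℝ) (n : ℕ)
    (X : ℕ → ℝ) (e : ℕ → Bool) :
    s ^ ((Finset.Icc 1 n).filter fun j => u < X j ∧ e j = true).card *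
      t ^ ((Finset.Icc 1 n).filter fun j => v < X j).card =
    ∏ i : Fin n, (1 - ((if e (i + 1) then 1 - s else 0) * if u < X (i + 1) then 1 else 0) -
      (if e (i + 1) then s * (1 - t) else 1 - t) * if v < X (i + 1) then 1 else 0) := by
  rw [← prod_Icc_one_eq_prod_fin n (fun j =>
    (1 - ((if e j then 1 - s else 0) * if u < X j then 1 else 0) -
      (if e j then s * (1 - t) else 1 - t) * if v < X j then 1 else 0)),
    ← Finset.prod_const, ← Finset.prod_const, Finset.prod_filter, Finset.prod_filter,
    ← Finset.prod_mul_distrib]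
  refine Finset.prod_congr rfl fun j _ => ?_
  by_cases he : e j = true <;> by_cases hu : u < X j <;> by_cases hv : v < X j <;>
    simp [he, hu, hv]
  all_goals first | exact absurd (huv.trans_lt hv) ‹_› | ring

theorem tendsto_integral_pow_card_mul_pow_card
    {Ω : Type} [MeasurableSpace Ω] (P : Measure Ω) [IsProbabilityMeasure P]
    {X : ℕ → Ω → ℝ} {ε : ℕ → Ω → Bool} {lam : Ω → ℝ} {γ : ℝ}
    (hγ : 0 ≤ γ)
    (hXmeas : ∀ n, Measurable (X n))
    (hεmeas : ∀ n, Measurable (ε n))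
    (hGauss : ∀ (m : ℕ) (idx : Fin m → ℕ) (c : Fin m → ℝ), ∃ v : ℝ≥0,
      Measure.map (fun ω => ∑ i, c i * X (idx i) ω) P = gaussianReal 0 v)
    (hstd : ∀ n, Measure.map (X n) P = gaussianReal 0 1)
    (hstat : ∀ (m k : ℕ),
      Measure.map (fun ω => fun i : Fin m => X (i.1 + 1 + k) ω) P =
        Measure.map (fun ω => fun i : Fin m => X (i.1 + 1) ω) P)
    (hr : Tendsto (fun n : ℕ => (∫ ω, X 1 ω * X (n + 1) ω ∂P) * Real.log n)
      atTop (nhds γ))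
    (hindep : IndepFun (fun ω => fun n => X n ω) (fun ω => fun n => ε n ω) P)
    (hS : TendstoInMeasure P
      (fun n ω => (∑ k ∈ Finset.Icc 1 n, (if ε k ω then (1 : ℝ) else 0)) / n) atTop lam)
    {x y : ℝ} (hxy : x ≤ y) {s t : ℝ} (hs : s ∈ Set.Icc (0 : ℝ) 1) (ht : t ∈ Set.Icc (0 : ℝ) 1) :
    Tendsto (fun n : ℕ => ∫ ω,
      s ^ ((Finset.Icc 1 n).filter fun j => un n x < X j ω ∧ ε j ω = true).card *
      t ^ ((Finset.Icc 1 n).filter fun j => un n y < X j ω).card ∂P) atTop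
      (nhds (∫ ω, ∫ z, exp (-(lam ω * ((1 - s) * g γ x z + s * (1 - t) * g γ y z)) -
        (1 - lam ω) * ((1 - t) * g γ y z)) ∂gaussianReal 0 1 ∂P)) := by
  obtain ⟨e, he0, he⟩ := exists_tendsto_abs_integral_prod_sub_le hγ hXmeas hGauss hstd hstat hr hxy
  have hs' := hs
  have ht' := ht
  obtain ⟨hs0, hs1⟩ := hs'
  obtain ⟨ht0, ht1⟩ := ht'
  let F : ℕ → (ℕ → ℝ) → (ℕ → Bool) → ℝ := fun n X e =>
    s ^ ((Finset.Icc 1 n).filter fun j => un n x < X j ∧ e j = true).card *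
      t ^ ((Finset.Icc 1 n).filter fun j => un n y < X j).card
  let α : Bool → ℝ := fun b => if b then 1 - s else 0
  let β : Bool → ℝ := fun b => if b then s * (1 - t) else 1 - t
  have hF : ∀ n X e, F n X e = ∏ i : Fin n,
      (1 - (α (e (i + 1)) * if un n x < X (i + 1) then 1 else 0) -
        β (e (i + 1)) * if un n y < X (i + 1) then 1 else 0) :=
    fun n X e => pow_card_mul_pow_card_eq_prod (un_mono hxy) s t n X e
  have hF1 : ∀ n X e, |F n X e| ≤ 1 := by
    intro n X e
    rw [abs_of_nonneg (by positivity)]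
    exact mul_le_one₀ (pow_le_one₀ hs0 hs1) (by positivity) (pow_le_one₀ ht0 ht1)
  have hFmeas : ∀ n, Measurable (Function.uncurry (F n)) := by
    intro n
    have : Function.uncurry (F n) = fun p : (ℕ → ℝ) × (ℕ → Bool) => ∏ i : Fin n,
      (1 - (α (p.2 (i + 1)) * if un n x < p.1 (i + 1) then 1 else 0) -
        β (p.2 (i + 1)) * if un n y < p.1 (i + 1) then 1 else 0) := by
      ext ⟨X, e⟩; exact hF n X e
    rw [this]
    refine Finset.measurable_fun_prod _ fun i _ => ?_
    have h1 : Measurable fun p : (ℕ → ℝ) × (ℕ → Bool) => p.1 (i + 1) := by fun_prop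
    have h2 : Measurable fun p : (ℕ → ℝ) × (ℕ → Bool) => p.2 (i + 1) := by fun_prop
    refine (measurable_const.sub (((Measurable.of_discrete (f := α)).comp h2).mul ?_)).sub
      (((Measurable.of_discrete (f := β)).comp h2).mul ?_)
    · exact Measurable.ite (measurableSet_lt measurable_const h1) measurable_const
        measurable_const
    · exact Measurable.ite (measurableSet_lt measurable_const h1) measurable_const
        measurable_const
  have hlim := tendsto_integral_integral_prod_condTail P hγ hεmeas hS x y hs ht
  refine (tendsto_iff_of_dist ?_).1 hlim
  have hα : ∀ b, 0 ≤ α b := fun b => by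
    simp only [α]; split_ifs <;> linarith
  have hβ : ∀ b, 0 ≤ β b := fun b => by
    simp only [β]; split_ifs
    · exact mul_nonneg hs0 (by linarith)
    · linarith
  have hαβ : ∀ b, α b + β b ≤ 1 := fun b => by
    simp only [α, β]; split_ifs
    · nlinarith
    · linarith
  refine squeeze_zero' (Eventually.of_forall fun n => dist_nonneg) ?_ he0
  filter_upwards [he] with n hn
  have h1 : ∫ ω, F n (fun j => X j ω) (fun j => ε j ω) ∂P =
      ∫ ω', ∫ ω, F n (fun j => X j ω) (fun j => ε j ω') ∂P ∂P :=
    integral_eq_integral_integral_of_indepFun (measurable_pi_iff.2 hXmeas)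
      (measurable_pi_iff.2 hεmeas) hindep (hFmeas n) (hF1 n)
  change |_ - ∫ ω, F n (fun j => X j ω) (fun j => ε j ω) ∂P| ≤ e n
  have hG1 : Integrable (fun ω' => ∫ ω, F n (fun j => X j ω) (fun j => ε j ω') ∂P) P := by
    refine Integrable.of_bound ?_ 1 (ae_of_all _ fun ω' => abs_integral_le_one P fun ω => hF1 n _ _)
    simp only [hF]
    exact (measurable_comp_fin_bool hεmeas n fun b => ∫ ω, ∏ i : Fin n,
      (1 - (α (b i) * if un n x < X (i + 1) ω then 1 else 0) -
        β (b i) * if un n y < X (i + 1) ω then 1 else 0) ∂P).aestronglyMeasurable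
  have hprod : ∀ ω z, ∏ j : Fin n, (if ε (j + 1) ω then
        1 - ((1 - s) * condTail γ n x z + s * (1 - t) * condTail γ n y z)
        else 1 - (1 - t) * condTail γ n y z) =
      ∏ i : Fin n, (1 - α (ε (i + 1) ω) * condTail γ n x z -
        β (ε (i + 1) ω) * condTail γ n y z) := by
    intro ω z
    refine Finset.prod_congr rfl fun i _ => ?_
    simp only [α, β]
    split_ifs <;> ring
  simp only [hprod]
  have hG2 : Integrable (fun ω' => ∫ z, ∏ i : Fin n, (1 - α (ε (i + 1) ω') * condTail γ n x z -
        β (ε (i + 1) ω') * condTail γ n y z) ∂gaussianReal 0 1) P := by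
    refine Integrable.of_bound (measurable_comp_fin_bool hεmeas n fun b => ∫ z, ∏ i : Fin n,
      (1 - α (b i) * condTail γ n x z - β (b i) * condTail γ n y z)
        ∂gaussianReal 0 1).aestronglyMeasurable 1 (ae_of_all _ fun ω' => abs_integral_le_one _
          fun z => abs_prod_le_one fun i => ?_)
    obtain ⟨hx0, hx1⟩ := condTail_mem_Icc γ n x z
    obtain ⟨hy0, hy1⟩ := condTail_mem_Icc γ n y z
    have h3 := mul_nonneg (hα (ε (i + 1) ω')) hx0
    have h4 := mul_nonneg (hβ (ε (i + 1) ω')) hy0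
    have h5 := mul_le_mul_of_nonneg_left hx1 (hα (ε (i + 1) ω'))
    have h6 := mul_le_mul_of_nonneg_left hy1 (hβ (ε (i + 1) ω'))
    have h7 := hαβ (ε (i + 1) ω')
    constructor <;> linarith
  rw [h1, ← integral_sub hG2 hG1]
  have hC : e n = e n * P.real Set.univ := by rw [probReal_univ, mul_one]
  rw [hC, ← Real.norm_eq_abs]
  refine norm_integral_le_of_norm_le_const (ae_of_all _ fun ω' => ?_)
  rw [Real.norm_eq_abs, abs_sub_comm]
  refine le_of_eq_of_le ?_ (hn (fun i => α (ε (i + 1) ω')) (fun i => β (ε (i + 1) ω'))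
    (fun i => hα _) (fun i => hβ _) fun i => hαβ _)
  congr 2
  exact integral_congr_ae (ae_of_all _ fun ω => hF n _ _)

lemma exists_polynomial_abs_eval_sub_indicator_le (K : ℕ) {δ : ℝ} (hδ : 0 < δ) :
    ∃ p : Polynomial ℝ, ∀ a : ℕ, |p.eval ((1 / 2 : ℝ) ^ a) - if a ≤ K then 1 else 0| ≤ δ := by
  obtain ⟨p, hp⟩ := exists_polynomial_near_of_continuousOn 0 1
    (fun u : ℝ => max 0 (min 1 (2 ^ (K + 1) * u - 1))) (by fun_prop) δ hδ
  refine ⟨p, fun a => ?_⟩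
  have h1 := hp ((1 / 2 : ℝ) ^ a) ⟨by positivity, pow_le_one₀ (by norm_num) (by norm_num)⟩
  have h2 : (2 : ℝ) ^ (K + 1) * (1 / 2) ^ a = 2 ^ (K + 1) / 2 ^ a := by
    rw [one_div, inv_pow]; rfl
  have h3 : (0 : ℝ) < 2 ^ a := by positivity
  have h4 : (if a ≤ K then (1 : ℝ) else 0) =
      max 0 (min 1 (2 ^ (K + 1) * (1 / 2 : ℝ) ^ a - 1)) := by
    split_ifs with h
    · have : (2 : ℝ) ≤ 2 ^ (K + 1) / 2 ^ a := by
        rw [le_div_iff₀ h3, ← pow_succ']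
        exact pow_le_pow_right₀ (by norm_num) (by lia)
      rw [h2, min_eq_left (by linarith), max_eq_right (by norm_num)]
    · have : (2 : ℝ) ^ (K + 1) / 2 ^ a ≤ 1 := by
        rw [div_le_one h3]
        exact pow_le_pow_right₀ (by norm_num) (by lia)
      rw [h2, max_eq_left ((min_le_right _ _).trans (by linarith))]
  rw [h4]
  exact h1.le

/-- Indicators of initial rectangles of `ℕ × ℕ` are uniform limits of polynomials in
`2⁻ᵃ` and `2⁻ᵇ`. -/
lemma exists_polynomial_abs_mul_eval_sub_indicator_le (K M : ℕ) {δ : ℝ} (hδ : 0 < δ) :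
    ∃ p q : Polynomial ℝ, ∀ a b : ℕ, |p.eval ((1 / 2 : ℝ) ^ a) * q.eval ((1 / 2 : ℝ) ^ b) -
      if a ≤ K ∧ b ≤ M then 1 else 0| ≤ δ := by
  have hη : 0 < min 1 (δ / 3) := by positivity
  obtain ⟨p, hp⟩ := exists_polynomial_abs_eval_sub_indicator_le K hη
  obtain ⟨q, hq⟩ := exists_polynomial_abs_eval_sub_indicator_le M hη
  refine ⟨p, q, fun a b => ?_⟩
  have hp := hp a
  have hq := hq b
  have h1 : min 1 (δ / 3) ≤ 1 := min_le_left _ _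
  have h2 : min 1 (δ / 3) ≤ δ / 3 := min_le_right _ _
  have h3 : (if a ≤ K ∧ b ≤ M then (1 : ℝ) else 0) =
      (if a ≤ K then 1 else 0) * if b ≤ M then 1 else 0 := by
    split_ifs <;> simp_all
  rw [h3]
  have hχ : |if a ≤ K then (1 : ℝ) else 0| ≤ 1 := by split_ifs <;> simp
  have hψ : |if b ≤ M then (1 : ℝ) else 0| ≤ 1 := by split_ifs <;> simp
  generalize (if a ≤ K then (1 : ℝ) else 0) = c at *
  generalize (if b ≤ M then (1 : ℝ) else 0) = d at *
  generalize min 1 (δ / 3) = η at *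
  have e : Polynomial.eval ((1 / 2) ^ a) p * Polynomial.eval ((1 / 2) ^ b) q - c * d =
      (Polynomial.eval ((1 / 2) ^ a) p - c) * (Polynomial.eval ((1 / 2) ^ b) q - d) +
      (Polynomial.eval ((1 / 2) ^ a) p - c) * d + c * (Polynomial.eval ((1 / 2) ^ b) q - d) := by
    ring
  rw [e]
  refine (abs_add_three _ _ _).trans ?_
  simp only [abs_mul]
  have i1 := mul_le_mul hp hq (abs_nonneg _) hη.le
  have i2 := mul_le_mul hp hψ (abs_nonneg _) hη.le
  have i3 := mul_le_mul hχ hq (abs_nonneg _) zero_le_one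
  nlinarith

lemma integral_pow_poissonMeasure (r : ℝ≥0) (s : ℝ) :
    ∫ n, s ^ n ∂poissonMeasure r = exp (r * (s - 1)) := by
  have h := (NormedSpace.expSeries_div_hasSum_exp (r * s : ℝ)).mul_left (exp (-r))
  rw [← exp_eq_exp_ℝ, ← exp_add] at h
  rw [integral_poissonMeasure, mul_sub, mul_one, sub_eq_neg_add, ← h.tsum_eq]
  refine tsum_congr fun n => ?_
  rw [smul_eq_mul, mul_pow]
  ring

lemma sum_indicator_eq_indicator (i d t k m : ℕ) (hk : 1 ≤ k) (hm : 1 ≤ m) :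
    (∑ t' ∈ Finset.range m, ∑ i' ∈ Finset.range (m - t'), ∑ j ∈ Finset.Icc i' (k - 1),
      if ((i, d), t) = ((i', j - i'), t') then (1 : ℝ) else 0) =
    if i + d ≤ k - 1 ∧ i + t ≤ m - 1 then 1 else 0 := by
  split_ifs with h
  · rw [Finset.sum_eq_single t, Finset.sum_eq_single i, Finset.sum_eq_single (i + d)]
    · simp
    · intro j hj hne
      rw [Finset.mem_Icc] at hj
      refine if_neg fun h => hne ?_
      simp only [Prod.mk.injEq] at h
      lia
    · intro h'; exact absurd (Finset.mem_Icc.2 ⟨by lia, h.1⟩) h'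
    · intro i' _ hne
      refine Finset.sum_eq_zero fun j _ => if_neg fun h => hne ?_
      simp only [Prod.mk.injEq] at h
      exact h.1.1.symm
    · intro h'; exact absurd (Finset.mem_range.2 (by lia)) h'
    · intro t' _ hne
      refine Finset.sum_eq_zero fun i' _ => Finset.sum_eq_zero fun j _ => if_neg fun h => hne ?_
      simp only [Prod.mk.injEq] at h
      exact h.2.symm
    · intro h'; exact absurd (Finset.mem_range.2 (by lia)) h'
  · refine Finset.sum_eq_zero fun t' ht => Finset.sum_eq_zero fun i' hi =>
      Finset.sum_eq_zero fun j hj => if_neg fun h' => h ?_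
    simp only [Prod.mk.injEq] at h'
    rw [Finset.mem_Icc] at hj
    rw [Finset.mem_range] at ht hi
    lia

/-- The summand of the limiting distribution. -/
noncomputable def limitTerm (γ x y : ℝ) (t i j : ℕ) (l z : ℝ) : ℝ :=
  ((1 - l) * g γ y z) ^ t / (Nat.factorial t : ℝ) * Real.exp (-((1 - l) * g γ y z)) *
    ((l * g γ y z) ^ i / (Nat.factorial i : ℝ) *
      ((l * (g γ x z - g γ y z)) ^ (j - i) / (Nat.factorial (j - i) : ℝ)) *
      Real.exp (-(l * g γ x z)))

lemma g_nonneg (γ x z : ℝ) : 0 ≤ g γ x z := (exp_pos _).le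

lemma g_anti (γ z : ℝ) {x y : ℝ} (hxy : x ≤ y) : g γ y z ≤ g γ x z :=
  exp_le_exp.2 (by linarith)

/-- The joint law of three independent Poisson variables: the numbers of observed exceedances
of the higher level, of observed values between the levels, and of unobserved exceedances of the
higher level. -/
theorem exists_measure_limitTerm {γ x y l : ℝ} (hxy : x ≤ y) (hl : l ∈ Set.Icc (0 : ℝ) 1)
    (z : ℝ) : ∃ μ : Measure ((ℕ × ℕ) × ℕ), IsProbabilityMeasure μ ∧
      (∀ t i j, μ.real {((i, j - i), t)} = limitTerm γ x y t i j l z) ∧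
      ∀ s t : ℝ, ∫ c, s ^ (c.1.1 + c.1.2) * t ^ (c.1.1 + c.2) ∂μ =
        exp (-(l * ((1 - s) * g γ x z + s * (1 - t) * g γ y z)) -
          (1 - l) * ((1 - t) * g γ y z)) := by
  have h1 : 0 ≤ l * g γ y z := mul_nonneg hl.1 (g_nonneg _ _ _)
  have h2 : 0 ≤ l * (g γ x z - g γ y z) := mul_nonneg hl.1 (sub_nonneg.2 (g_anti γ z hxy))
  have h3 : 0 ≤ (1 - l) * g γ y z := mul_nonneg (sub_nonneg.2 hl.2) (g_nonneg _ _ _)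
  refine ⟨((poissonMeasure (l * g γ y z).toNNReal).prod (poissonMeasure (l * (g γ x z - g γ y z)).toNNReal)).prod 
      (poissonMeasure ((1 - l) * g γ y z).toNNReal),
    inferInstance, fun t i j => ?_, fun s t => ?_⟩
  · rw [← Set.singleton_prod_singleton, ← Set.singleton_prod_singleton, measureReal_prod_prod,
      measureReal_prod_prod, poissonMeasure_real_singleton, poissonMeasure_real_singleton,
      poissonMeasure_real_singleton, limitTerm]
    have : exp (-(l * g γ x z)) = exp (-(l * g γ y z)) * exp (-(l * (g γ x z - g γ y z))) := by
      rw [← exp_add]; congr 1; ring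
    rw [this]
    rw [coe_toNNReal _ h1, coe_toNNReal _ h2, coe_toNNReal _ h3]
    ring
  · have e : ∀ c : (ℕ × ℕ) × ℕ, s ^ (c.1.1 + c.1.2) * t ^ (c.1.1 + c.2) =
        ((s * t) ^ c.1.1 * s ^ c.1.2) * t ^ c.2 := fun c => by
      rw [pow_add, pow_add, mul_pow]; ring
    simp only [e]
    rw [integral_prod_mul (fun p : ℕ × ℕ => (s * t) ^ p.1 * s ^ p.2) (fun n : ℕ => t ^ n),
      integral_prod_mul (fun n : ℕ => (s * t) ^ n) (fun n : ℕ => s ^ n),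
      integral_pow_poissonMeasure, integral_pow_poissonMeasure, integral_pow_poissonMeasure,
      ← exp_add, ← exp_add]
    rw [coe_toNNReal _ h1, coe_toNNReal _ h2, coe_toNNReal _ h3]
    congr 1
    ring

lemma measurable_g (γ x : ℝ) : Measurable (g γ x) := by
  unfold g
  fun_prop

lemma measurable_limitTerm (γ x y : ℝ) (t i j : ℕ) :
    Measurable (Function.uncurry (limitTerm γ x y t i j)) := by
  have hx : Measurable fun p : ℝ × ℝ => g γ x p.2 := (measurable_g γ x).comp measurable_snd
  have hy : Measurable fun p : ℝ × ℝ => g γ y p.2 := (measurable_g γ y).comp measurable_snd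
  change Measurable fun p : ℝ × ℝ => limitTerm γ x y t i j p.1 p.2
  unfold limitTerm
  fun_prop

lemma abs_limitTerm_le_one {γ x y l : ℝ} (hxy : x ≤ y) (hl : l ∈ Set.Icc (0 : ℝ) 1) (z : ℝ)
    (t i j : ℕ) : |limitTerm γ x y t i j l z| ≤ 1 := by
  obtain ⟨μ, hμ, h, -⟩ := exists_measure_limitTerm (γ := γ) hxy hl z
  rw [← h, abs_of_nonneg measureReal_nonneg]
  exact measureReal_le_one

/-- The generating function approximates the limiting distribution pointwise as soon as the
polynomials approximate the indicator. -/
theorem abs_sum_coeff_mul_exp_sub_sum_limitTerm_le {γ x y l : ℝ} (hxy : x ≤ y)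
    (hl : l ∈ Set.Icc (0 : ℝ) 1) (z : ℝ) {k m : ℕ} (hk : 1 ≤ k) (hm : 1 ≤ m)
    {p q : Polynomial ℝ} {δ : ℝ}
    (hpq : ∀ a b : ℕ, |p.eval ((1 / 2 : ℝ) ^ a) * q.eval ((1 / 2 : ℝ) ^ b) -
      if a ≤ k - 1 ∧ b ≤ m - 1 then 1 else 0| ≤ δ) :
    |(∑ a ∈ Finset.range (p.natDegree + 1), ∑ b ∈ Finset.range (q.natDegree + 1),
        p.coeff a * q.coeff b *
        exp (-(l * ((1 - (1 / 2 : ℝ) ^ a) * g γ x z +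
          (1 / 2 : ℝ) ^ a * (1 - (1 / 2 : ℝ) ^ b) * g γ y z)) -
          (1 - l) * ((1 - (1 / 2 : ℝ) ^ b) * g γ y z))) -
      ∑ t ∈ Finset.range m, ∑ i ∈ Finset.range (m - t), ∑ j ∈ Finset.Icc i (k - 1),
        limitTerm γ x y t i j l z| ≤ δ := by
  obtain ⟨μ, hμ, h1, h2⟩ := exists_measure_limitTerm (γ := γ) hxy hl z
  have hi : ∀ a b : ℕ, Integrable (fun c : (ℕ × ℕ) × ℕ => ((1 / 2 : ℝ) ^ a) ^ (c.1.1 + c.1.2) *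
      ((1 / 2 : ℝ) ^ b) ^ (c.1.1 + c.2)) μ := fun a b => by
    refine Integrable.of_bound (Measurable.of_discrete).aestronglyMeasurable 1
      (ae_of_all _ fun c => ?_)
    rw [norm_of_nonneg (by positivity), ← pow_mul, ← pow_mul]
    exact mul_le_one₀ (pow_le_one₀ (by norm_num) (by norm_num)) (by positivity)
      (pow_le_one₀ (by norm_num) (by norm_num))
  have hind : ∀ t i j, Integrable (fun c : (ℕ × ℕ) × ℕ =>
      if c = ((i, j - i), t) then (1 : ℝ) else 0) μ := fun t i j => by
    refine Integrable.of_bound (Measurable.of_discrete).aestronglyMeasurable 1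
      (ae_of_all _ fun c => ?_)
    split_ifs <;> simp
  have e1 : (∑ a ∈ Finset.range (p.natDegree + 1), ∑ b ∈ Finset.range (q.natDegree + 1),
        p.coeff a * q.coeff b *
        exp (-(l * ((1 - (1 / 2 : ℝ) ^ a) * g γ x z +
          (1 / 2 : ℝ) ^ a * (1 - (1 / 2 : ℝ) ^ b) * g γ y z)) -
          (1 - l) * ((1 - (1 / 2 : ℝ) ^ b) * g γ y z))) =
      ∫ c, ∑ a ∈ Finset.range (p.natDegree + 1), ∑ b ∈ Finset.range (q.natDegree + 1),
        p.coeff a * q.coeff b * (((1 / 2 : ℝ) ^ a) ^ (c.1.1 + c.1.2) *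
          ((1 / 2 : ℝ) ^ b) ^ (c.1.1 + c.2)) ∂μ := by
    rw [integral_finsetSum _ fun a _ => integrable_finsetSum _ fun b _ => (hi a b).const_mul _]
    refine Finset.sum_congr rfl fun a _ => ?_
    rw [integral_finsetSum _ fun b _ => (hi a b).const_mul _]
    refine Finset.sum_congr rfl fun b _ => ?_
    rw [integral_const_mul, h2]
  have e2 : (∑ t ∈ Finset.range m, ∑ i ∈ Finset.range (m - t), ∑ j ∈ Finset.Icc i (k - 1),
        limitTerm γ x y t i j l z) =
      ∫ c, ∑ t ∈ Finset.range m, ∑ i ∈ Finset.range (m - t), ∑ j ∈ Finset.Icc i (k - 1),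
        (if c = ((i, j - i), t) then (1 : ℝ) else 0) ∂μ := by
    rw [integral_finsetSum _ fun t _ => integrable_finsetSum _ fun i _ =>
      integrable_finsetSum _ fun j _ => hind t i j]
    refine Finset.sum_congr rfl fun t _ => ?_
    rw [integral_finsetSum _ fun i _ => integrable_finsetSum _ fun j _ => hind t i j]
    refine Finset.sum_congr rfl fun i _ => ?_
    rw [integral_finsetSum _ fun j _ => hind t i j]
    refine Finset.sum_congr rfl fun j _ => ?_
    rw [← h1, ← integral_indicator_one (measurableSet_singleton _)]
    refine integral_congr_ae (ae_of_all _ fun c => ?_)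
    simp [Set.indicator_apply]
  rw [e1, e2, ← integral_sub (integrable_finsetSum _ fun a _ => integrable_finsetSum _ fun b _ =>
    (hi a b).const_mul _) (integrable_finsetSum _ fun t _ => integrable_finsetSum _ fun i _ =>
      integrable_finsetSum _ fun j _ => hind t i j)]
  have hδ : δ = δ * μ.real Set.univ := by rw [probReal_univ, mul_one]
  rw [hδ, ← Real.norm_eq_abs]
  refine norm_integral_le_of_norm_le_const (ae_of_all _ fun c => ?_)
  obtain ⟨⟨i, d⟩, t⟩ := c
  rw [Real.norm_eq_abs, sum_indicator_eq_indicator i d t k m hk hm]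
  refine le_of_eq_of_le ?_ (hpq (i + d) (i + t))
  rw [Polynomial.eval_eq_sum_range, Polynomial.eval_eq_sum_range, Finset.sum_mul_sum]
  congr 2
  refine Finset.sum_congr rfl fun a _ => Finset.sum_congr rfl fun b _ => ?_
  rw [pow_right_comm _ a, pow_right_comm _ b]
  ring

/-- Iterated integrals against the law of `lam` and the standard Gaussian measure. -/
lemma integral_integral_comp_eq_integral_prod {Ω : Type} [MeasurableSpace Ω] {P : Measure Ω}
    [IsProbabilityMeasure P] {lam : Ω → ℝ} (hlam : Measurable lam) {f : ℝ → ℝ → ℝ}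
    (hf : Measurable (Function.uncurry f))
    (hi : Integrable (Function.uncurry f) ((P.map lam).prod (gaussianReal 0 1))) :
    ∫ ω, ∫ z, f (lam ω) z ∂gaussianReal 0 1 ∂P =
      ∫ p, Function.uncurry f p ∂(P.map lam).prod (gaussianReal 0 1) := by
  have := Measure.isProbabilityMeasure_map (μ := P) hlam.aemeasurable
  rw [integral_prod _ hi]
  exact (integral_map hlam.aemeasurable
    hf.stronglyMeasurable.integral_prod_right'.aestronglyMeasurable).symm

lemma ae_prod_fst_mem {Ω : Type} [MeasurableSpace Ω] {P : Measure Ω}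
    [IsProbabilityMeasure P] {lam : Ω → ℝ} (hlam : Measurable lam)
    (hlam01 : ∀ᵐ ω ∂P, lam ω ∈ Set.Icc (0 : ℝ) 1) :
    ∀ᵐ p ∂(P.map lam).prod (gaussianReal 0 1), p.1 ∈ Set.Icc (0 : ℝ) 1 := by
  have := Measure.isProbabilityMeasure_map (μ := P) hlam.aemeasurable
  exact Measure.quasiMeasurePreserving_fst.ae
    ((ae_map_iff hlam.aemeasurable measurableSet_Icc).2 hlam01)

lemma measurable_card_filter {Ω : Type} [MeasurableSpace Ω] {p : ℕ → Ω → Prop}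
    [∀ j ω, Decidable (p j ω)]
    (hp : ∀ j, MeasurableSet {ω | p j ω}) (n : ℕ) :
    Measurable fun ω => ((Finset.Icc 1 n).filter fun j => p j ω).card := by
  simp only [Finset.card_filter]
  exact Finset.measurable_fun_sum _ fun j _ =>
    Measurable.ite (hp j) measurable_const measurable_const

lemma integrable_uncurry_of_abs_le_one {Ω : Type} [MeasurableSpace Ω] {P : Measure Ω}
    [IsProbabilityMeasure P] {lam : Ω → ℝ} (hlam : Measurable lam)
    (hlam01 : ∀ᵐ ω ∂P, lam ω ∈ Set.Icc (0 : ℝ) 1) {f : ℝ → ℝ → ℝ}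
    (hf : Measurable (Function.uncurry f)) (h1 : ∀ l ∈ Set.Icc (0 : ℝ) 1, ∀ z, |f l z| ≤ 1) :
    Integrable (Function.uncurry f) ((P.map lam).prod (gaussianReal 0 1)) := by
  have := Measure.isProbabilityMeasure_map (μ := P) hlam.aemeasurable
  refine Integrable.of_bound hf.aestronglyMeasurable 1 ?_
  filter_upwards [ae_prod_fst_mem hlam hlam01] with p hp using h1 p.1 hp p.2

lemma abs_exp_le_one {γ x y l s t : ℝ} (hl : l ∈ Set.Icc (0 : ℝ) 1)
    (hs : s ∈ Set.Icc (0 : ℝ) 1) (ht : t ∈ Set.Icc (0 : ℝ) 1) (z : ℝ) :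
    |exp (-(l * ((1 - s) * g γ x z + s * (1 - t) * g γ y z)) -
      (1 - l) * ((1 - t) * g γ y z))| ≤ 1 := by
  have hx := g_nonneg γ x z
  have hy := g_nonneg γ y z
  have hs0 := hs.1
  have hl0 := hl.1
  have hs1 := sub_nonneg.2 hs.2
  have hl1 := sub_nonneg.2 hl.2
  have ht1 := sub_nonneg.2 ht.2
  rw [abs_of_pos (exp_pos _), exp_le_one_iff]
  have h1 : 0 ≤ l * ((1 - s) * g γ x z + s * (1 - t) * g γ y z) := by positivity
  have h2 : 0 ≤ (1 - l) * ((1 - t) * g γ y z) := by positivity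
  linarith

theorem stmt1
    {Ω : Type} [MeasurableSpace Ω] (P : Measure Ω) [IsProbabilityMeasure P]
    (X : ℕ → Ω → ℝ) (ε : ℕ → Ω → Bool) (lam : Ω → ℝ) (γ : ℝ)
    (hγ : 0 ≤ γ)
    (hXmeas : ∀ n, Measurable (X n))
    (hεmeas : ∀ n, Measurable (ε n))
    (hlam : Measurable lam)
    -- every finite-dimensional distribution of `X` is centered Gaussian
    (hGauss : ∀ (m : ℕ) (idx : Fin m → ℕ) (c : Fin m → ℝ), ∃ v : ℝ≥0,
      Measure.map (fun ω => ∑ i, c i * X (idx i) ω) P = gaussianReal 0 v)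
    -- each `X n` is standard Gaussian
    (hstd : ∀ n, Measure.map (X n) P = gaussianReal 0 1)
    -- stationarity
    (hstat : ∀ (m k : ℕ),
      Measure.map (fun ω => fun i : Fin m => X (i.1 + 1 + k) ω) P =
        Measure.map (fun ω => fun i : Fin m => X (i.1 + 1) ω) P)
    -- `r_n ln n → γ`
    (hr : Tendsto (fun n : ℕ => (∫ ω, X 1 ω * X (n + 1) ω ∂P) * Real.log n)
      atTop (nhds γ))
    -- independence of the sequences `X` and `ε`
    (hindep : IndepFun (fun ω => fun n => X n ω) (fun ω => fun n => ε n ω) P)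
    (hlam01 : ∀ᵐ ω ∂P, lam ω ∈ Set.Icc (0 : ℝ) 1)
    -- `S_n / n → λ` in probability
    (hS : TendstoInMeasure P
      (fun n ω => (∑ k ∈ Finset.Icc 1 n, (if ε k ω then (1 : ℝ) else 0)) / n)
      atTop lam)
    (k m : ℕ) (hk : 1 ≤ k) (hm : 1 ≤ m) (x y : ℝ) (hxy : x < y) :
    Tendsto (fun n : ℕ =>
      (P {ω | ((Finset.Icc 1 n).filter
            (fun j => un n x < X j ω ∧ ε j ω = true)).card ≤ k - 1 ∧
          ((Finset.Icc 1 n).filter (fun j => un n y < X j ω)).card ≤ m - 1}).toReal)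
      atTop
      (nhds (∑ t ∈ Finset.range m, ∑ i ∈ Finset.range (m - t), ∑ j ∈ Finset.Icc i (k - 1),
        ∫ ω, ∫ z,
          ((1 - lam ω) * g γ y z) ^ t / (Nat.factorial t : ℝ) *
            Real.exp (-((1 - lam ω) * g γ y z)) *
          ((lam ω * g γ y z) ^ i / (Nat.factorial i : ℝ) *
            ((lam ω * (g γ x z - g γ y z)) ^ (j - i) / (Nat.factorial (j - i) : ℝ)) *
            Real.exp (-(lam ω * g γ x z)))
          ∂(gaussianReal 0 1) ∂P)) := by
  have hρ := Measure.isProbabilityMeasure_map (μ := P) hlam.aemeasurable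
  have hterm : ∀ t i j, Integrable (Function.uncurry (limitTerm γ x y t i j))
      ((P.map lam).prod (gaussianReal 0 1)) := fun t i j =>
    integrable_uncurry_of_abs_le_one hlam hlam01 (measurable_limitTerm γ x y t i j)
      fun l hl z => abs_limitTerm_le_one hxy.le hl z t i j
  have htarget : (∑ t ∈ Finset.range m, ∑ i ∈ Finset.range (m - t), ∑ j ∈ Finset.Icc i (k - 1),
      ∫ ω, ∫ z, limitTerm γ x y t i j (lam ω) z ∂(gaussianReal 0 1) ∂P) =
      ∫ c, ∑ t ∈ Finset.range m, ∑ i ∈ Finset.range (m - t), ∑ j ∈ Finset.Icc i (k - 1),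
        Function.uncurry (limitTerm γ x y t i j) c ∂(P.map lam).prod (gaussianReal 0 1) := by
    rw [integral_finsetSum _ fun t _ => integrable_finsetSum _ fun i _ =>
      integrable_finsetSum _ fun j _ => hterm t i j]
    refine Finset.sum_congr rfl fun t _ => ?_
    rw [integral_finsetSum _ fun i _ => integrable_finsetSum _ fun j _ => hterm t i j]
    refine Finset.sum_congr rfl fun i _ => ?_
    rw [integral_finsetSum _ fun j _ => hterm t i j]
    exact Finset.sum_congr rfl fun j _ => integral_integral_comp_eq_integral_prod hlam
      (measurable_limitTerm γ x y t i j) (hterm t i j)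
  change Tendsto _ atTop (nhds (∑ t ∈ Finset.range m, ∑ i ∈ Finset.range (m - t),
    ∑ j ∈ Finset.Icc i (k - 1), ∫ ω, ∫ z, limitTerm γ x y t i j (lam ω) z ∂(gaussianReal 0 1) ∂P))
  rw [htarget, Metric.tendsto_nhds]
  intro η hη
  obtain ⟨p, q, hpq⟩ := exists_polynomial_abs_mul_eval_sub_indicator_le (k - 1) (m - 1)
    (show 0 < η / 4 by positivity)
  have hhalf : ∀ a : ℕ, (1 / 2 : ℝ) ^ a ∈ Set.Icc (0 : ℝ) 1 := fun a =>
    ⟨by positivity, pow_le_one₀ (by norm_num) (by norm_num)⟩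
  let E : ℕ → ℕ → ℝ → ℝ → ℝ := fun a b l z =>
    exp (-(l * ((1 - (1 / 2 : ℝ) ^ a) * g γ x z +
      (1 / 2 : ℝ) ^ a * (1 - (1 / 2 : ℝ) ^ b) * g γ y z)) -
      (1 - l) * ((1 - (1 / 2 : ℝ) ^ b) * g γ y z))
  have hEmeas : ∀ a b, Measurable (Function.uncurry (E a b)) := by
    intro a b
    have hx : Measurable fun p : ℝ × ℝ => g γ x p.2 := (measurable_g γ x).comp measurable_snd
    have hy : Measurable fun p : ℝ × ℝ => g γ y p.2 := (measurable_g γ y).comp measurable_snd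
    change Measurable fun p : ℝ × ℝ => E a b p.1 p.2
    fun_prop
  have hEint : ∀ a b, Integrable (Function.uncurry (E a b))
      ((P.map lam).prod (gaussianReal 0 1)) := fun a b =>
    integrable_uncurry_of_abs_le_one hlam hlam01 (hEmeas a b)
      fun l hl z => abs_exp_le_one hl (hhalf a) (hhalf b) z
  let N : ℕ → Ω → ℕ := fun n ω =>
    ((Finset.Icc 1 n).filter fun j => un n x < X j ω ∧ ε j ω = true).card
  let M : ℕ → Ω → ℕ := fun n ω => ((Finset.Icc 1 n).filter fun j => un n y < X j ω).card
  have hNmeas : ∀ n, Measurable (N n) := fun n => measurable_card_filter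
    (p := fun j ω => un n x < X j ω ∧ ε j ω = true) (fun j => (measurableSet_lt measurable_const (hXmeas j)).inter
      (hεmeas j (measurableSet_singleton true))) n
  have hMmeas : ∀ n, Measurable (M n) := fun n => measurable_card_filter
    (p := fun j ω => un n y < X j ω) (fun j => measurableSet_lt measurable_const (hXmeas j)) n
  have hpow : ∀ n a b, Integrable (fun ω => ((1 / 2 : ℝ) ^ a) ^ N n ω * ((1 / 2 : ℝ) ^ b) ^ M n ω)
      P := fun n a b => by
    refine Integrable.of_bound (((Measurable.of_discrete.comp (hNmeas n)).mul
      (Measurable.of_discrete.comp (hMmeas n))).aestronglyMeasurable) 1 (ae_of_all _ fun ω => ?_)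
    rw [norm_of_nonneg (by positivity)]
    exact mul_le_one₀ (pow_le_one₀ (hhalf a).1 (hhalf a).2) (by positivity)
      (pow_le_one₀ (hhalf b).1 (hhalf b).2)
  have hlim : Tendsto (fun n => ∑ a ∈ Finset.range (p.natDegree + 1),
      ∑ b ∈ Finset.range (q.natDegree + 1), p.coeff a * q.coeff b *
        ∫ ω, ((1 / 2 : ℝ) ^ a) ^ N n ω * ((1 / 2 : ℝ) ^ b) ^ M n ω ∂P) atTop
      (nhds (∑ a ∈ Finset.range (p.natDegree + 1),
      ∑ b ∈ Finset.range (q.natDegree + 1), p.coeff a * q.coeff b *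
        ∫ ω, ∫ z, E a b (lam ω) z ∂gaussianReal 0 1 ∂P)) :=
    tendsto_finsetSum _ fun a _ => tendsto_finsetSum _ fun b _ =>
      (tendsto_integral_pow_card_mul_pow_card P hγ hXmeas hεmeas hGauss hstd hstat hr hindep hS
        hxy.le (hhalf a) (hhalf b)).const_mul _
  have hW : (∑ a ∈ Finset.range (p.natDegree + 1),
      ∑ b ∈ Finset.range (q.natDegree + 1), p.coeff a * q.coeff b *
        ∫ ω, ∫ z, E a b (lam ω) z ∂gaussianReal 0 1 ∂P) =
      ∫ c, ∑ a ∈ Finset.range (p.natDegree + 1), ∑ b ∈ Finset.range (q.natDegree + 1),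
        p.coeff a * q.coeff b * Function.uncurry (E a b) c
          ∂(P.map lam).prod (gaussianReal 0 1) := by
    rw [integral_finsetSum _ fun a _ => integrable_finsetSum _ fun b _ =>
      (hEint a b).const_mul _]
    refine Finset.sum_congr rfl fun a _ => ?_
    rw [integral_finsetSum _ fun b _ => (hEint a b).const_mul _]
    refine Finset.sum_congr rfl fun b _ => ?_
    rw [integral_const_mul, integral_integral_comp_eq_integral_prod hlam (hEmeas a b) (hEint a b)]
  rw [hW] at hlim
  have hclose : |(∫ c, ∑ a ∈ Finset.range (p.natDegree + 1),
      ∑ b ∈ Finset.range (q.natDegree + 1), p.coeff a * q.coeff b * Function.uncurry (E a b) c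
          ∂(P.map lam).prod (gaussianReal 0 1)) -
      ∫ c, ∑ t ∈ Finset.range m, ∑ i ∈ Finset.range (m - t), ∑ j ∈ Finset.Icc i (k - 1),
        Function.uncurry (limitTerm γ x y t i j) c ∂(P.map lam).prod (gaussianReal 0 1)| ≤
      η / 4 := by
    rw [← integral_sub (integrable_finsetSum _ fun a _ => integrable_finsetSum _ fun b _ =>
      (hEint a b).const_mul _) (integrable_finsetSum _ fun t _ => integrable_finsetSum _ fun i _ =>
        integrable_finsetSum _ fun j _ => hterm t i j)]
    have h4 : η / 4 = η / 4 * ((P.map lam).prod (gaussianReal 0 1)).real Set.univ := by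
      rw [probReal_univ, mul_one]
    rw [h4, ← Real.norm_eq_abs]
    refine norm_integral_le_of_norm_le_const ?_
    filter_upwards [ae_prod_fst_mem hlam hlam01] with c hc
    exact abs_sum_coeff_mul_exp_sub_sum_limitTerm_le hxy.le hc c.2 hk hm hpq
  filter_upwards [(Metric.tendsto_nhds.1 hlim) (η / 4) (by positivity)] with n hn
  have hA : MeasurableSet {ω | N n ω ≤ k - 1 ∧ M n ω ≤ m - 1} :=
    (measurableSet_le (hNmeas n) measurable_const).inter
      (measurableSet_le (hMmeas n) measurable_const)
  have hprob : |P.real {ω | N n ω ≤ k - 1 ∧ M n ω ≤ m - 1} -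
      ∑ a ∈ Finset.range (p.natDegree + 1), ∑ b ∈ Finset.range (q.natDegree + 1),
        p.coeff a * q.coeff b *
          ∫ ω, ((1 / 2 : ℝ) ^ a) ^ N n ω * ((1 / 2 : ℝ) ^ b) ^ M n ω ∂P| ≤ η / 4 := by
    have h1 : (∑ a ∈ Finset.range (p.natDegree + 1), ∑ b ∈ Finset.range (q.natDegree + 1),
        p.coeff a * q.coeff b *
          ∫ ω, ((1 / 2 : ℝ) ^ a) ^ N n ω * ((1 / 2 : ℝ) ^ b) ^ M n ω ∂P) =
        ∫ ω, ∑ a ∈ Finset.range (p.natDegree + 1), ∑ b ∈ Finset.range (q.natDegree + 1),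
          p.coeff a * q.coeff b *
            (((1 / 2 : ℝ) ^ a) ^ N n ω * ((1 / 2 : ℝ) ^ b) ^ M n ω) ∂P := by
      rw [integral_finsetSum _ fun a _ => integrable_finsetSum _ fun b _ =>
        (hpow n a b).const_mul _]
      refine Finset.sum_congr rfl fun a _ => ?_
      rw [integral_finsetSum _ fun b _ => (hpow n a b).const_mul _]
      refine Finset.sum_congr rfl fun b _ => ?_
      rw [integral_const_mul]
    have hI : Integrable ({ω | N n ω ≤ k - 1 ∧ M n ω ≤ m - 1}.indicator (1 : Ω → ℝ)) P :=
      (integrable_const (1 : ℝ)).indicator hA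
    rw [h1, ← integral_indicator_one hA, ← integral_sub hI
      (integrable_finsetSum _ fun a _ => integrable_finsetSum _ fun b _ =>
        (hpow n a b).const_mul _)]
    have h4 : η / 4 = η / 4 * P.real Set.univ := by rw [probReal_univ, mul_one]
    rw [h4, ← Real.norm_eq_abs]
    refine norm_integral_le_of_norm_le_const (ae_of_all _ fun ω => ?_)
    rw [Real.norm_eq_abs, abs_sub_comm]
    refine le_of_eq_of_le ?_ (hpq (N n ω) (M n ω))
    rw [Polynomial.eval_eq_sum_range, Polynomial.eval_eq_sum_range, Finset.sum_mul_sum,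
      Set.indicator_apply]
    congr 2
    refine Finset.sum_congr rfl fun a _ => Finset.sum_congr rfl fun b _ => ?_
    rw [pow_right_comm _ a, pow_right_comm _ b]
    ring
  rw [Real.dist_eq] at hn ⊢
  change |P.real {ω | N n ω ≤ k - 1 ∧ M n ω ≤ m - 1} - _| < η
  rw [abs_lt] at hn ⊢
  rw [abs_le] at hprob hclose
  constructor <;> linarith
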